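/- arXiv:2104.12740 — 2 statements merged into one kernel-verified Lean document; each statement's English description precedes it below -/
import Mathlib

section
/- Let S be a nonnegative discrete-time martingale. The following are equivalent: (a) there exists k ∈ ℕ such that E[S_{τ_k}] < E[S₀], where τ₀ = 0 and τ_k is the k-th drawdown time of S; (b) there exists k ≥ 0 such that E[S_{τ̃_k}] < E[S_k], where τ̃_k := inf{j > k : S_j < S_{j-1}}; (c) there exists k ≥ 0 such that lim_{n→∞} E[(S_n − S_∞) 1_{{S_k ≤ S_{k+1} ≤ ⋯ ≤ S_n}}] > 0. -/
open MeasureTheory Filter Set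

noncomputable section

variable {Ω : Type*}

/-- Evaluation of a discrete-time process at a possibly infinite random time `τ`,
using the limit variable `Sinf` on the event `{τ = ∞}`. -/
def evalAt (S : ℕ → Ω → ℝ) (Sinf : Ω → ℝ) (τ : Ω → ℕ∞) (ω : Ω) : ℝ :=
  if τ ω = ⊤ then Sinf ω else S (τ ω).toNat ω

/-- The `k`-th drawdown time of `S`: `τ₀ = 0` and
`τ_k = inf {j > τ_{k-1} : S_j < S_{j-1}}` (with value `∞` if no such `j` exists). -/
def drawdown (S : ℕ → Ω → ℝ) : ℕ → Ω → ℕ∞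
  | 0 => fun _ => 0
  | (k + 1) => fun ω =>
      sInf {j : ℕ∞ | drawdown S k ω < j ∧ ∃ n : ℕ, j = (n : ℕ∞) ∧ S n ω < S (n - 1) ω}

/-- The first drawdown of `S` after the deterministic time `k`:
`τ̃_k = inf {j > k : S_j < S_{j-1}}`. -/
def drawdownAfter (S : ℕ → Ω → ℝ) (k : ℕ) (ω : Ω) : ℕ∞ :=
  sInf {j : ℕ∞ | (k : ℕ∞) < j ∧ ∃ n : ℕ, j = (n : ℕ∞) ∧ S n ω < S (n - 1) ω}

/-- The process stopped at a possibly infinite random time. -/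
def stoppedAt (S : ℕ → Ω → ℝ) (τ : Ω → ℕ∞) (n : ℕ) (ω : Ω) : ℝ :=
  S ((min (n : ℕ∞) (τ ω)).toNat) ω

/-- The event `{S_k ≤ S_{k+1} ≤ ⋯ ≤ S_n}`. -/
def monoEvent (S : ℕ → Ω → ℝ) (k n : ℕ) : Set Ω :=
  {ω | ∀ j, k ≤ j → j < n → S j ω ≤ S (j + 1) ω}

/-- `S` is a bubble under `P`: it loses mass at its `k`-th drawdown time for some `k ≥ 1`. -/
def IsBubble [MeasurableSpace Ω] (S : ℕ → Ω → ℝ) (Sinf : Ω → ℝ) (P : Measure Ω) : Prop :=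
  ∃ k : ℕ, ∫ ω, evalAt S Sinf (drawdown S (k + 1)) ω ∂P < ∫ ω, S 0 ω ∂P

end

section FatouLimit

variable {Ω : Type*} {m0 : MeasurableSpace Ω} {μ : Measure Ω}

/-- Fatou's lemma for the Bochner integral: an a.e. limit of nonnegative integrable functions
whose integrals are bounded by `c` is integrable, with integral at most `c`. -/
theorem integrable_and_integral_le_of_tendsto {f : ℕ → Ω → ℝ} {g : Ω → ℝ} {c : ℝ}
    (hfi : ∀ n, Integrable (f n) μ) (hnn : ∀ n ω, 0 ≤ f n ω)
    (hc : ∀ᶠ n in atTop, ∫ ω, f n ω ∂μ ≤ c)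
    (hlim : ∀ᵐ ω ∂μ, Tendsto (fun n => f n ω) atTop (nhds (g ω))) :
    Integrable g μ ∧ ∫ ω, g ω ∂μ ≤ c := by
  have hgm : AEStronglyMeasurable g μ :=
    aestronglyMeasurable_of_tendsto_ae atTop (fun n => (hfi n).aestronglyMeasurable) hlim
  have hg0 : 0 ≤ᵐ[μ] g := by
    filter_upwards [hlim] with ω h
    exact ge_of_tendsto' h fun n => hnn n ω
  have hc0 : 0 ≤ c := by
    obtain ⟨n, hn⟩ := hc.exists
    exact (integral_nonneg (hnn n)).trans hn
  have hle : ∫⁻ ω, ENNReal.ofReal (g ω) ∂μ ≤ ENNReal.ofReal c := by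
    calc ∫⁻ ω, ENNReal.ofReal (g ω) ∂μ
        = ∫⁻ ω, liminf (fun n => ENNReal.ofReal (f n ω)) atTop ∂μ := by
          refine lintegral_congr_ae ?_
          filter_upwards [hlim] with ω h
          exact ((ENNReal.continuous_ofReal.tendsto _).comp h).liminf_eq.symm
      _ ≤ liminf (fun n => ∫⁻ ω, ENNReal.ofReal (f n ω) ∂μ) atTop :=
          lintegral_liminf_le' fun n => (hfi n).aemeasurable.ennreal_ofReal
      _ ≤ ENNReal.ofReal c := by
          refine liminf_le_of_frequently_le' (Eventually.frequently ?_)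
          filter_upwards [hc] with n hn
          rw [← ofReal_integral_eq_lintegral_ofReal (hfi n) (ae_of_all _ (hnn n))]
          exact ENNReal.ofReal_le_ofReal hn
  have hgi : Integrable g μ := by
    refine ⟨hgm, ?_⟩
    rw [hasFiniteIntegral_iff_ofReal hg0]
    exact hle.trans_lt ENNReal.ofReal_lt_top
  refine ⟨hgi, ?_⟩
  rw [← ofReal_integral_eq_lintegral_ofReal hgi hg0] at hle
  exact (ENNReal.ofReal_le_ofReal_iff hc0).1 hle

end FatouLimit

section NextDrop

variable {Ω : Type*} {S : ℕ → Ω → ℝ} {σ τ : Ω → ℕ∞} {ω : Ω}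

/-- The first drawdown of `S` strictly after the random time `σ`. -/
noncomputable def nextDrop (S : ℕ → Ω → ℝ) (σ : Ω → ℕ∞) (ω : Ω) : ℕ∞ :=
  sInf {j : ℕ∞ | σ ω < j ∧ ∃ n : ℕ, j = (n : ℕ∞) ∧ S n ω < S (n - 1) ω}

theorem drawdown_succ (S : ℕ → Ω → ℝ) (k : ℕ) :
    drawdown S (k + 1) = nextDrop S (drawdown S k) := rfl

theorem drawdownAfter_eq_nextDrop (S : ℕ → Ω → ℝ) (k : ℕ) :
    drawdownAfter S k = nextDrop S fun _ => (k : ℕ∞) := rfl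

theorem nextDrop_mono (h : σ ω ≤ τ ω) : nextDrop S σ ω ≤ nextDrop S τ ω :=
  sInf_le_sInf fun _ hj => ⟨h.trans_lt hj.1, hj.2⟩

theorem nextDrop_of_eq_coe {m : ℕ} (h : σ ω = m) : nextDrop S σ ω = drawdownAfter S m ω := by
  rw [drawdownAfter_eq_nextDrop]
  exact le_antisymm (nextDrop_mono h.le) (nextDrop_mono h.ge)

theorem add_one_le_nextDrop : σ ω + 1 ≤ nextDrop S σ ω :=
  le_sInf fun _ hj => Order.add_one_le_of_lt hj.1

theorem nextDrop_of_eq_top (h : σ ω = ⊤) : nextDrop S σ ω = ⊤ := by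
  have := add_one_le_nextDrop (S := S) (σ := σ) (ω := ω)
  rwa [h, top_add, top_le_iff] at this

theorem coe_lt_nextDrop_iff {n : ℕ} :
    (n : ℕ∞) < nextDrop S σ ω ↔ ∀ j ≤ n, σ ω < j → S (j - 1) ω ≤ S j ω := by
  constructor
  · intro h j hj hσ
    by_contra! hlt
    have h1 : nextDrop S σ ω ≤ j := sInf_le ⟨hσ, j, rfl, hlt⟩
    exact absurd (h.trans_le h1) (not_lt.2 (by exact_mod_cast hj))
  · intro h
    have h1 : (n : ℕ∞) + 1 ≤ nextDrop S σ ω := by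
      refine le_sInf ?_
      rintro _ ⟨hσ, j, rfl, hlt⟩
      by_contra! hj
      have hj' : j ≤ n := Nat.lt_succ_iff.1 (by exact_mod_cast hj)
      exact absurd (h j hj' hσ) (not_le.2 hlt)
    exact (ENat.add_one_le_iff (ENat.natCast_ne_top n)).1 h1

theorem le_drawdown (S : ℕ → Ω → ℝ) (k : ℕ) (ω : Ω) : (k : ℕ∞) ≤ drawdown S k ω := by
  induction k with
  | zero => simp
  | succ k ih =>
    rw [drawdown_succ, Nat.cast_succ]
    exact (add_le_add_left ih 1).trans add_one_le_nextDrop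

theorem drawdownAfter_le_drawdown_succ (S : ℕ → Ω → ℝ) (k : ℕ) (ω : Ω) :
    drawdownAfter S k ω ≤ drawdown S (k + 1) ω := by
  rw [drawdown_succ, drawdownAfter_eq_nextDrop]
  exact nextDrop_mono (le_drawdown S k ω)

theorem monoEvent_eq (S : ℕ → Ω → ℝ) (k n : ℕ) :
    monoEvent S k n = {ω | (n : ℕ∞) < drawdownAfter S k ω} := by
  ext ω
  simp only [monoEvent, drawdownAfter_eq_nextDrop, mem_ofPred_eq, coe_lt_nextDrop_iff]
  constructor
  · intro h j hj hk
    obtain _ | j := j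
    · simp at hk
    · exact h j (Nat.lt_succ_iff.1 (by exact_mod_cast hk)) hj
  · intro h j hk hj
    exact h (j + 1) hj (by exact_mod_cast Nat.lt_succ_of_le hk)

end NextDrop

section StoppingTimes

variable {Ω : Type*} {m0 : MeasurableSpace Ω} {ℱ : Filtration ℕ m0} {τ : Ω → ℕ∞}

theorem measurableSet_lt_coe_of_coe_lt
    (hτ : ∀ n : ℕ, MeasurableSet[ℱ n] {ω | (n : ℕ∞) < τ ω}) {j n : ℕ} (hj : j ≤ n) :
    MeasurableSet[ℱ n] {ω | τ ω < j} := by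
  obtain _ | j := j
  · simp
  · have : {ω | τ ω < (j + 1 : ℕ)} = {ω | (j : ℕ∞) < τ ω}ᶜ := by
      ext ω
      simp only [mem_ofPred_eq, mem_compl_iff, not_lt, Nat.cast_succ]
      exact ENat.lt_add_one_iff (ENat.natCast_ne_top j)
    rw [this]
    exact ℱ.mono (by lia) _ (hτ j).compl

theorem measurableSet_eq_coe_of_coe_lt
    (hτ : ∀ n : ℕ, MeasurableSet[ℱ n] {ω | (n : ℕ∞) < τ ω}) (n : ℕ) :
    MeasurableSet[ℱ n] {ω | τ ω = n} := by
  have : {ω | τ ω = n} = {ω | (n : ℕ∞) < τ ω}ᶜ ∩ {ω | τ ω < n}ᶜ := by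
    ext ω
    simp only [mem_ofPred_eq, mem_compl_iff, not_lt, mem_inter_iff]
    exact le_antisymm_iff
  rw [this]
  exact (hτ n).compl.inter (measurableSet_lt_coe_of_coe_lt hτ le_rfl).compl

theorem measurableSet_coe_lt_nextDrop {S : ℕ → Ω → ℝ}
    (hS : ∀ n, StronglyMeasurable[ℱ n] (S n))
    (hτ : ∀ n : ℕ, MeasurableSet[ℱ n] {ω | (n : ℕ∞) < τ ω}) (n : ℕ) :
    MeasurableSet[ℱ n] {ω | (n : ℕ∞) < nextDrop S τ ω} := by
  simp only [coe_lt_nextDrop_iff]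
  have : {ω | ∀ j ≤ n, τ ω < j → S (j - 1) ω ≤ S j ω} =
      ⋂ j ∈ Finset.range (n + 1), ({ω | τ ω < j}ᶜ ∪ {ω | S (j - 1) ω ≤ S j ω}) := by
    ext ω
    simp only [mem_ofPred_eq, mem_iInter, Finset.mem_range, Nat.lt_succ_iff, mem_union,
      mem_compl_iff, imp_iff_not_or]
  rw [this]
  refine Finset.measurableSet_biInter _ fun j hj => ?_
  have hj : j ≤ n := Nat.lt_succ_iff.1 (Finset.mem_range.1 hj)
  refine (measurableSet_lt_coe_of_coe_lt hτ hj).compl.union ?_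
  exact @measurableSet_le _ _ _ _ _ (ℱ n) _ _ _ _ _
    ((hS (j - 1)).mono (ℱ.mono ((Nat.sub_le j 1).trans hj))).measurable ((hS j).mono (ℱ.mono hj)).measurable

theorem measurableSet_coe_lt_drawdownAfter {S : ℕ → Ω → ℝ}
    (hS : ∀ n, StronglyMeasurable[ℱ n] (S n)) (k n : ℕ) :
    MeasurableSet[ℱ n] {ω | (n : ℕ∞) < drawdownAfter S k ω} := by
  rw [drawdownAfter_eq_nextDrop]
  exact measurableSet_coe_lt_nextDrop hS (fun _ => MeasurableSet.const _) n

theorem measurableSet_coe_lt_drawdown {S : ℕ → Ω → ℝ}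
    (hS : ∀ n, StronglyMeasurable[ℱ n] (S n)) (k n : ℕ) :
    MeasurableSet[ℱ n] {ω | (n : ℕ∞) < drawdown S k ω} := by
  induction k generalizing n with
  | zero => simp [drawdown]
  | succ k ih => exact measurableSet_coe_lt_nextDrop hS ih n

end StoppingTimes

section Stopping

variable {Ω : Type*} {S : ℕ → Ω → ℝ} {Sinf : Ω → ℝ} {τ : Ω → ℕ∞} {ω : Ω}

theorem stoppedAt_of_coe_lt {n : ℕ} (h : (n : ℕ∞) < τ ω) : stoppedAt S τ n ω = S n ω := by
  simp [stoppedAt, min_eq_left h.le]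

theorem stoppedAt_succ_of_coe_lt {n : ℕ} (h : (n : ℕ∞) < τ ω) :
    stoppedAt S τ (n + 1) ω = S (n + 1) ω := by
  have h1 : ((n + 1 : ℕ) : ℕ∞) ≤ τ ω := by
    rw [Nat.cast_succ]
    exact Order.add_one_le_of_lt h
  simp only [stoppedAt, min_eq_left h1, ENat.toNat_natCast]

theorem stoppedAt_of_le_coe {n : ℕ} (h : τ ω ≤ n) : stoppedAt S τ n ω = evalAt S Sinf τ ω := by
  have h1 : τ ω ≠ ⊤ := ne_top_of_le_ne_top (ENat.natCast_ne_top n) h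
  simp [stoppedAt, evalAt, min_eq_right h, h1]

theorem stoppedAt_succ_sub (S : ℕ → Ω → ℝ) (τ : Ω → ℕ∞) (n : ℕ) :
    stoppedAt S τ (n + 1) =
      fun ω => stoppedAt S τ n ω + {ω | (n : ℕ∞) < τ ω}.indicator (S (n + 1) - S n) ω := by
  funext ω
  by_cases h : (n : ℕ∞) < τ ω
  · rw [indicator_of_mem (by exact h), stoppedAt_of_coe_lt h, stoppedAt_succ_of_coe_lt h]
    simp
  · have h1 : τ ω ≤ n := not_lt.1 h
    have h2 : τ ω ≤ (n + 1 : ℕ) := h1.trans (by exact_mod_cast n.le_succ)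
    rw [indicator_of_notMem (by exact h), add_zero, stoppedAt_of_le_coe (Sinf := 0) h1,
      stoppedAt_of_le_coe (Sinf := 0) h2]

theorem tendsto_stoppedAt (h : Tendsto (fun n => S n ω) atTop (nhds (Sinf ω))) :
    Tendsto (fun n => stoppedAt S τ n ω) atTop (nhds (evalAt S Sinf τ ω)) := by
  by_cases hτ : τ ω = ⊤
  · have h1 : ∀ n, stoppedAt S τ n ω = S n ω := fun n =>
      stoppedAt_of_coe_lt (hτ ▸ ENat.natCast_lt_top n)
    simpa only [h1, evalAt, hτ, if_true] using h
  · refine tendsto_const_nhds.congr' ?_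
    filter_upwards [eventually_ge_atTop (τ ω).toNat] with n hn
    refine (stoppedAt_of_le_coe ?_).symm
    rw [← ENat.natCast_toNat hτ]
    exact_mod_cast hn

theorem evalAt_of_eq_coe {n : ℕ} (h : τ ω = n) : evalAt S Sinf τ ω = S n ω := by
  simp [evalAt, h]

theorem evalAt_congr {σ : Ω → ℕ∞} (h : σ ω = τ ω) : evalAt S Sinf σ ω = evalAt S Sinf τ ω := by
  simp only [evalAt, h]

end Stopping

section Martingale

variable {Ω : Type*} {m0 : MeasurableSpace Ω} {P : Measure Ω}
  {ℱ : Filtration ℕ m0} {S : ℕ → Ω → ℝ} {Sinf : Ω → ℝ} {σ τ : Ω → ℕ∞}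

theorem MeasureTheory.Martingale.integrable_stoppedAt (hmart : Martingale S ℱ P)
    (hτ : ∀ n : ℕ, MeasurableSet[ℱ n] {ω | (n : ℕ∞) < τ ω}) (n : ℕ) :
    Integrable (stoppedAt S τ n) P := by
  induction n with
  | zero =>
    convert hmart.integrable 0 using 1
    funext ω
    simp [stoppedAt]
  | succ n ih =>
    rw [stoppedAt_succ_sub]
    exact ih.add (((hmart.integrable _).sub (hmart.integrable _)).indicator (ℱ.le n _ (hτ n)))

variable [IsProbabilityMeasure P]

theorem MeasureTheory.Martingale.integral_eq_integral_zero (hmart : Martingale S ℱ P) (n : ℕ) :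
    ∫ ω, S n ω ∂P = ∫ ω, S 0 ω ∂P := by
  simpa using (hmart.setIntegral_eq (Nat.zero_le n) MeasurableSet.univ).symm

theorem MeasureTheory.Martingale.integral_stoppedAt (hmart : Martingale S ℱ P)
    (hτ : ∀ n : ℕ, MeasurableSet[ℱ n] {ω | (n : ℕ∞) < τ ω}) (n : ℕ) :
    ∫ ω, stoppedAt S τ n ω ∂P = ∫ ω, S 0 ω ∂P := by
  induction n with
  | zero => simp [stoppedAt]
  | succ n ih =>
    have hm := ℱ.le n _ (hτ n)
    have hi := (hmart.integrable (n + 1)).sub (hmart.integrable n)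
    rw [stoppedAt_succ_sub, integral_add (hmart.integrable_stoppedAt hτ n) (hi.indicator hm), ih,
      integral_indicator hm, integral_sub' (hmart.integrable _).integrableOn
      (hmart.integrable _).integrableOn, hmart.setIntegral_eq n.le_succ (hτ n)]
    simp

theorem integrable_evalAt (hmart : Martingale S ℱ P) (hnn : ∀ n ω, 0 ≤ S n ω)
    (hconv : ∀ᵐ ω ∂P, Tendsto (fun n => S n ω) atTop (nhds (Sinf ω)))
    (hτ : ∀ n : ℕ, MeasurableSet[ℱ n] {ω | (n : ℕ∞) < τ ω}) :
    Integrable (evalAt S Sinf τ) P :=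
  (integrable_and_integral_le_of_tendsto (hmart.integrable_stoppedAt hτ) (fun _ _ => hnn _ _)
    (Eventually.of_forall fun n => (hmart.integral_stoppedAt hτ n).le)
    (hconv.mono fun _ h => tendsto_stoppedAt h)).1

theorem integrable_limit (hmart : Martingale S ℱ P) (hnn : ∀ n ω, 0 ≤ S n ω)
    (hconv : ∀ᵐ ω ∂P, Tendsto (fun n => S n ω) atTop (nhds (Sinf ω))) : Integrable Sinf P :=
  (integrable_and_integral_le_of_tendsto hmart.integrable hnn
    (Eventually.of_forall fun n => (hmart.integral_eq_integral_zero n).le) hconv).1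

theorem setIntegral_limit_le (hmart : Martingale S ℱ P) (hnn : ∀ n ω, 0 ≤ S n ω)
    (hconv : ∀ᵐ ω ∂P, Tendsto (fun n => S n ω) atTop (nhds (Sinf ω))) {n : ℕ} {A : Set Ω}
    (hA : MeasurableSet[ℱ n] A) : ∫ ω in A, Sinf ω ∂P ≤ ∫ ω in A, S n ω ∂P := by
  refine (integrable_and_integral_le_of_tendsto (fun m => (hmart.integrable m).integrableOn) hnn
    ?_ (ae_restrict_of_ae hconv)).2
  filter_upwards [eventually_ge_atTop n] with m hm
  exact (hmart.setIntegral_eq hm hA).ge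

/-- The mass lost by a nonnegative martingale at a stopping time `τ` is the limit of
`E[(S_n - S_∞) 1_{n < τ}]`. -/
theorem tendsto_setIntegral_sub_limit (hmart : Martingale S ℱ P) (hnn : ∀ n ω, 0 ≤ S n ω)
    (hconv : ∀ᵐ ω ∂P, Tendsto (fun n => S n ω) atTop (nhds (Sinf ω)))
    (hτ : ∀ n : ℕ, MeasurableSet[ℱ n] {ω | (n : ℕ∞) < τ ω}) :
    Tendsto (fun n : ℕ => ∫ ω in {ω | (n : ℕ∞) < τ ω}, (S n ω - Sinf ω) ∂P) atTop
      (nhds (∫ ω, S 0 ω ∂P - ∫ ω, evalAt S Sinf τ ω ∂P)) := by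
  have hSinf := integrable_limit hmart hnn hconv
  have hev := integrable_evalAt hmart hnn hconv hτ
  have hm : ∀ n : ℕ, MeasurableSet {ω | (n : ℕ∞) < τ ω} := fun n => ℱ.le n _ (hτ n)
  have hD : Integrable (fun ω => Sinf ω - evalAt S Sinf τ ω) P := hSinf.sub hev
  have hzero : Tendsto (fun n : ℕ =>
      ∫ ω, {ω | (n : ℕ∞) < τ ω}.indicator (fun ω => Sinf ω - evalAt S Sinf τ ω) ω ∂P) atTop
      (nhds (∫ _, (0 : ℝ) ∂P)) := by
    refine tendsto_integral_of_dominated_convergence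
      (fun ω => ‖Sinf ω - evalAt S Sinf τ ω‖) (fun n => (hD.indicator (hm n)).aestronglyMeasurable)
      hD.norm (fun n => ae_of_all _ fun ω => norm_indicator_le_norm_self _ _)
      (ae_of_all _ fun ω => ?_)
    refine tendsto_const_nhds.congr' ?_
    by_cases h : τ ω = ⊤
    · refine Eventually.of_forall fun n => ?_
      simp [indicator, evalAt, h]
    · filter_upwards [eventually_ge_atTop (τ ω).toNat] with n hn
      rw [indicator_of_notMem]
      simp only [mem_ofPred_eq, not_lt]
      rw [← ENat.natCast_toNat h]
      exact_mod_cast hn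
  have key : ∀ n : ℕ, ∫ ω in {ω | (n : ℕ∞) < τ ω}, (S n ω - Sinf ω) ∂P =
      (∫ ω, S 0 ω ∂P - ∫ ω, evalAt S Sinf τ ω ∂P) -
      ∫ ω, {ω | (n : ℕ∞) < τ ω}.indicator (fun ω => Sinf ω - evalAt S Sinf τ ω) ω ∂P := by
    intro n
    have hst := hmart.integrable_stoppedAt hτ n
    have hd : Integrable (fun ω => stoppedAt S τ n ω - evalAt S Sinf τ ω) P := hst.sub hev
    rw [← hmart.integral_stoppedAt hτ n, ← integral_sub hst hev,
      ← integral_sub hd (hD.indicator (hm n)), ← integral_indicator (hm n)]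
    refine integral_congr_ae (ae_of_all _ fun ω => ?_)
    by_cases h : (n : ℕ∞) < τ ω
    · simp only [indicator_of_mem (show ω ∈ {ω | (n : ℕ∞) < τ ω} from h), stoppedAt_of_coe_lt h]
      simp
    · simp only [indicator_of_notMem (show ω ∉ {ω | (n : ℕ∞) < τ ω} from h),
        stoppedAt_of_le_coe (Sinf := Sinf) (S := S) (not_lt.1 h)]
      simp
  simp only [key]
  simpa using hzero.const_sub (∫ ω, S 0 ω ∂P - ∫ ω, evalAt S Sinf τ ω ∂P)

/-- A nonnegative martingale is a supermartingale along possibly infinite stopping times. -/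
theorem integral_evalAt_anti (hmart : Martingale S ℱ P) (hnn : ∀ n ω, 0 ≤ S n ω)
    (hconv : ∀ᵐ ω ∂P, Tendsto (fun n => S n ω) atTop (nhds (Sinf ω)))
    (hσ : ∀ n : ℕ, MeasurableSet[ℱ n] {ω | (n : ℕ∞) < σ ω})
    (hτ : ∀ n : ℕ, MeasurableSet[ℱ n] {ω | (n : ℕ∞) < τ ω}) (hle : ∀ ω, σ ω ≤ τ ω) :
    ∫ ω, evalAt S Sinf τ ω ∂P ≤ ∫ ω, evalAt S Sinf σ ω ∂P := by
  have hSinf := integrable_limit hmart hnn hconv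
  have h := le_of_tendsto_of_tendsto' (tendsto_setIntegral_sub_limit hmart hnn hconv hσ)
    (tendsto_setIntegral_sub_limit hmart hnn hconv hτ) fun n => ?_
  · linarith
  have hi : Integrable (fun ω => S n ω - Sinf ω) P := (hmart.integrable n).sub hSinf
  have hsub : {ω | (n : ℕ∞) < σ ω} ⊆ {ω | (n : ℕ∞) < τ ω} := fun ω h => lt_of_lt_of_le h (hle ω)
  have hdiff := setIntegral_limit_le hmart hnn hconv ((hτ n).diff (hσ n))
  rw [← sub_nonneg, ← integral_sub (hmart.integrable n).integrableOn hSinf.integrableOn,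
    setIntegral_sdiff (ℱ.le n _ (hσ n)) hi.integrableOn hsub] at hdiff
  linarith

/-- If no mass is lost between `m` and the next drawdown, then none is lost on any event known at
time `m`. -/
theorem setIntegral_evalAt_drawdownAfter (hmart : Martingale S ℱ P) (hnn : ∀ n ω, 0 ≤ S n ω)
    (hconv : ∀ᵐ ω ∂P, Tendsto (fun n => S n ω) atTop (nhds (Sinf ω))) {m : ℕ}
    (hm : ∫ ω, S m ω ∂P ≤ ∫ ω, evalAt S Sinf (drawdownAfter S m) ω ∂P) {B : Set Ω}
    (hB : MeasurableSet[ℱ m] B) :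
    ∫ ω in B, S m ω ∂P ≤ ∫ ω in B, evalAt S Sinf (drawdownAfter S m) ω ∂P := by
  classical
  have hadp : ∀ n, StronglyMeasurable[ℱ n] (S n) := hmart.stronglyMeasurable
  have hτ := measurableSet_coe_lt_drawdownAfter hadp m
  have hmlt : ∀ ω, (m : ℕ∞) < drawdownAfter S m ω := fun ω => by
    rw [drawdownAfter_eq_nextDrop, coe_lt_nextDrop_iff]
    intro j hj hlt
    exact absurd (by exact_mod_cast hlt) hj.not_gt
  have hB' := ℱ.le m _ hB
  set ρ : Ω → ℕ∞ := B.piecewise (drawdownAfter S m) (fun _ => (m : ℕ∞)) with hρ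
  have hρB : ∀ ω ∈ B, ρ ω = drawdownAfter S m ω := fun ω h => piecewise_eq_of_mem _ _ _ h
  have hρBc : ∀ ω ∈ Bᶜ, ρ ω = m := fun ω h => piecewise_eq_of_notMem _ _ _ h
  have hρm : ∀ n : ℕ, MeasurableSet[ℱ n] {ω | (n : ℕ∞) < ρ ω} := by
    intro n
    obtain hn | hn := lt_or_ge n m
    · convert MeasurableSet.univ (m := ℱ n)
      refine eq_univ_of_forall fun ω => ?_
      have hnm : (n : ℕ∞) < m := by exact_mod_cast hn
      by_cases h : ω ∈ B
      · exact (hnm.trans (hmlt ω)).trans_eq (hρB ω h).symm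
      · exact hnm.trans_eq (hρBc ω h).symm
    · have : {ω | (n : ℕ∞) < ρ ω} = B ∩ {ω | (n : ℕ∞) < drawdownAfter S m ω} := by
        ext ω
        by_cases h : ω ∈ B
        · simp [h, hρB ω h]
        · simp [h, hρBc ω h, hn]
      rw [this]
      exact (ℱ.mono hn _ hB).inter (hτ n)
  have hle : ∀ ω, ρ ω ≤ drawdownAfter S m ω := fun ω => by
    by_cases h : ω ∈ B
    · exact (hρB ω h).le
    · exact (hρBc ω h).trans_le (hmlt ω).le
  have h1 := integral_evalAt_anti hmart hnn hconv hρm hτ hle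
  rw [← integral_add_compl hB' (integrable_evalAt hmart hnn hconv hρm),
    setIntegral_congr_fun hB' (fun ω h => evalAt_congr (hρB ω h)),
    setIntegral_congr_fun hB'.compl (fun ω h => evalAt_of_eq_coe (hρBc ω h))] at h1
  have h2 := integral_add_compl hB' (hmart.integrable m)
  linarith

theorem integral_evalAt_drawdown_le_succ (hmart : Martingale S ℱ P) (hnn : ∀ n ω, 0 ≤ S n ω)
    (hconv : ∀ᵐ ω ∂P, Tendsto (fun n => S n ω) atTop (nhds (Sinf ω)))
    (hno : ∀ m : ℕ, ∫ ω, S m ω ∂P ≤ ∫ ω, evalAt S Sinf (drawdownAfter S m) ω ∂P) (k : ℕ) :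
    ∫ ω, evalAt S Sinf (drawdown S k) ω ∂P ≤ ∫ ω, evalAt S Sinf (drawdown S (k + 1)) ω ∂P := by
  have hadp : ∀ n, StronglyMeasurable[ℱ n] (S n) := hmart.stronglyMeasurable
  have hk := measurableSet_coe_lt_drawdown hadp k
  have hi := integrable_evalAt hmart hnn hconv hk
  have hi' := integrable_evalAt hmart hnn hconv (measurableSet_coe_lt_drawdown hadp (k + 1))
  have hfin : ∀ m : ℕ, MeasurableSet {ω | drawdown S k ω = m} := fun m =>
    ℱ.le m _ (measurableSet_eq_coe_of_coe_lt hk m)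
  have hmeas : ∀ j : ℕ∞, MeasurableSet {ω | drawdown S k ω = j} := by
    intro j
    induction j using ENat.recTopCoe with
    | coe m => exact hfin m
    | top =>
      have : {ω | drawdown S k ω = ⊤} = (⋃ m : ℕ, {ω | drawdown S k ω = m})ᶜ := by
        ext ω
        simp only [mem_ofPred_eq, mem_compl_iff, mem_iUnion, not_exists]
        exact ENat.eq_top_iff_forall_ne.trans (forall_congr' fun m => ne_comm)
      rw [this]
      exact (MeasurableSet.iUnion hfin).compl
  have hunion : ⋃ j : ℕ∞, {ω | drawdown S k ω = j} = univ :=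
    eq_univ_of_forall fun ω => mem_iUnion.2 ⟨_, rfl⟩
  have hdisj : Pairwise (Function.onFun Disjoint fun j : ℕ∞ => {ω | drawdown S k ω = j}) :=
    fun i j hij => disjoint_left.2 fun ω h h' => hij (h.symm.trans h')
  have hsum := hasSum_integral_iUnion hmeas hdisj (f := evalAt S Sinf (drawdown S k)) (μ := P)
    hi.integrableOn
  have hsum' := hasSum_integral_iUnion hmeas hdisj (f := evalAt S Sinf (drawdown S (k + 1)))
    (μ := P) hi'.integrableOn
  rw [hunion, setIntegral_univ] at hsum hsum'
  refine hasSum_le (fun j => ?_) hsum hsum'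
  induction j using ENat.recTopCoe with
  | coe m =>
    rw [setIntegral_congr_fun (hfin m) (fun ω h => evalAt_of_eq_coe h),
      drawdown_succ, setIntegral_congr_fun (g := evalAt S Sinf (drawdownAfter S m)) (hfin m)
        (fun ω h => evalAt_congr (nextDrop_of_eq_coe h))]
    exact setIntegral_evalAt_drawdownAfter hmart hnn hconv (hno m)
      (measurableSet_eq_coe_of_coe_lt hk m)
  | top =>
    refine (setIntegral_congr_fun (hmeas ⊤) fun ω h => evalAt_congr ?_).le
    exact h.trans (nextDrop_of_eq_top h).symm

end Martingale


/-- Equivalent characterisations of a bubble: (a) `S` loses mass at some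
drawdown time; (b) `E[S_{τ̃_k}] < E[S_k]` for some `k`; (c) for some `k`,
`lim_n E[(S_n - S_∞) 1_{{S_k ≤ ⋯ ≤ S_n}}] > 0`. -/
theorem isBubble_iff_char
    {Ω : Type*} {m0 : MeasurableSpace Ω} {P : Measure Ω} [IsProbabilityMeasure P]
    {ℱ : Filtration ℕ m0} {S : ℕ → Ω → ℝ} (hmart : Martingale S ℱ P)
    (hnn : ∀ n ω, 0 ≤ S n ω) {Sinf : Ω → ℝ}
    (hconv : ∀ᵐ ω ∂P, Tendsto (fun n => S n ω) atTop (nhds (Sinf ω))) :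
    (IsBubble S Sinf P ↔
      ∃ k : ℕ, ∫ ω, evalAt S Sinf (drawdownAfter S k) ω ∂P < ∫ ω, S k ω ∂P) ∧
    (IsBubble S Sinf P ↔
      ∃ k : ℕ, ∃ L > (0 : ℝ),
        Tendsto
          (fun n => ∫ ω, (S n ω - Sinf ω) * (monoEvent S k n).indicator (fun _ => (1 : ℝ)) ω ∂P)
          atTop (nhds L)) := by
  have hadp : ∀ n, StronglyMeasurable[ℱ n] (S n) := hmart.stronglyMeasurable
  have hab : IsBubble S Sinf P ↔
      ∃ k : ℕ, ∫ ω, evalAt S Sinf (drawdownAfter S k) ω ∂P < ∫ ω, S k ω ∂P := by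
    constructor
    · rintro ⟨k, hk⟩
      by_contra! hno
      refine hk.not_ge ?_
      have h0 : ∫ ω, evalAt S Sinf (drawdown S 0) ω ∂P = ∫ ω, S 0 ω ∂P := by
        simp [evalAt, drawdown]
      rw [← h0]
      exact monotone_nat_of_le_succ
        (f := fun k => ∫ ω, evalAt S Sinf (drawdown S k) ω ∂P)
        (integral_evalAt_drawdown_le_succ hmart hnn hconv hno) (Nat.zero_le _)
    · rintro ⟨k, hk⟩
      refine ⟨k, ?_⟩
      rw [← hmart.integral_eq_integral_zero k]
      exact (integral_evalAt_anti hmart hnn hconv (measurableSet_coe_lt_drawdownAfter hadp k)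
        (measurableSet_coe_lt_drawdown hadp (k + 1))
        fun ω => drawdownAfter_le_drawdown_succ S k ω).trans_lt hk
  refine ⟨hab, hab.trans (exists_congr fun k => ?_)⟩
  have hτ := measurableSet_coe_lt_drawdownAfter hadp k
  have hlim := tendsto_setIntegral_sub_limit hmart hnn hconv hτ
  have heq : ∀ n : ℕ,
      ∫ ω, (S n ω - Sinf ω) * (monoEvent S k n).indicator (fun _ => (1 : ℝ)) ω ∂P =
      ∫ ω in {ω | (n : ℕ∞) < drawdownAfter S k ω}, (S n ω - Sinf ω) ∂P := by
    intro n
    rw [monoEvent_eq, ← integral_indicator (ℱ.le n _ (hτ n))]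
    refine integral_congr_ae (ae_of_all _ fun ω => ?_)
    simp [indicator]
  simp only [heq]
  rw [← hmart.integral_eq_integral_zero k] at hlim
  constructor
  · exact fun h => ⟨_, sub_pos.2 h, hlim⟩
  · rintro ⟨L, hL, hL'⟩
    exact sub_pos.1 (tendsto_nhds_unique hlim hL' ▸ hL)
end

section
/- Let S be the complete-market (binary) Markov martingale with kernel K(x,·) = a(x)δ_{b(x)x/a(x)} + (1−a(x))δ_{(1−b(x))x/(1−a(x))}, where 0 ≤ b(x) < a(x) < 1 and 0 < liminf_{x→∞} a(x) ≤ limsup_{x→∞} a(x) < 1, and b is nonincreasing on [x_b,∞) for some x_b > 0. Then S is a bubble under P_x if and only if S is not P_x-a.s. bounded and ∫_{log x_b}^∞ b(e^u) du < ∞. -/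
open MeasureTheory Filter Set

noncomputable section

open ProbabilityTheory

/-- A positive time-homogeneous Markov martingale on `(0, ∞)` with transition kernel `K`,
together with its family of laws `P x` (start at `x`) and the a.s. limit `Sinf`. -/
structure MarkovMartingale (Ω : Type*) [m0 : MeasurableSpace Ω] where
  P : ℝ → Measure Ω
  F : Filtration ℕ m0
  S : ℕ → Ω → ℝ
  Sinf : Ω → ℝ
  K : Kernel ℝ ℝ
  markov : IsMarkovKernel K
  prob : ∀ x, 0 < x → IsProbabilityMeasure (P x)
  pos : ∀ x, 0 < x → ∀ᵐ ω ∂P x, ∀ n, 0 < S n ω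
  start : ∀ x, 0 < x → ∀ᵐ ω ∂P x, S 0 ω = x
  mart : ∀ x, 0 < x → Martingale S F (P x)
  conv : ∀ x, 0 < x → ∀ᵐ ω ∂P x, Tendsto (fun n => S n ω) atTop (nhds (Sinf ω))
  kernel_pos : ∀ x, 0 < x → K x (Set.Iic 0) = 0
  kernel_int : ∀ x, 0 < x → Integrable id (K x)
  kernel_mart : ∀ x, 0 < x → ∫ y, y ∂(K x) = x
  step : ∀ x, 0 < x → ∀ n : ℕ, ∀ g : ℝ → ℝ, Measurable g → (∃ C, ∀ y, |g y| ≤ C) →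
    (P x)[fun ω => g (S (n + 1) ω) | F n] =ᵐ[P x] fun ω => ∫ y, g y ∂(K (S n ω))

namespace MarkovMartingale

variable {Ω : Type*} [MeasurableSpace Ω]

/-- The probability `a(x) = K(x, [0,x))` of a downward move from `x`. -/
def a (M : MarkovMartingale Ω) (x : ℝ) : ℝ := (M.K x (Set.Ico 0 x)).toReal

/-- The relative recovery `b(x) = (1/x) ∫_{[0,x)} y K(x,dy)` upon a downward move. -/
def b (M : MarkovMartingale Ω) (x : ℝ) : ℝ := (1 / x) * ∫ y in Set.Ico 0 x, y ∂(M.K x)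

/-- The relaxed relative recovery `b_ε(x) = (1/x) ∫_{[0,x(1+ε))} y K(x,dy)`. -/
def bEps (M : MarkovMartingale Ω) (ε x : ℝ) : ℝ :=
  (1 / x) * ∫ y in Set.Ico 0 (x * (1 + ε)), y ∂(M.K x)

/-- `S` is a bubble under `P_x`. -/
def Bubble (M : MarkovMartingale Ω) (x : ℝ) : Prop := IsBubble M.S M.Sinf (M.P x)

/-- `S` is `P_x`-a.s. bounded. -/
def Bounded (M : MarkovMartingale Ω) (x : ℝ) : Prop :=
  ∃ C : ℝ, ∀ᵐ ω ∂M.P x, ∀ n, M.S n ω ≤ C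

/-- The default function `M_S(x) = x - E_x[S_{τ₁}]`, the loss of mass at the first
drawdown. -/
def defaultFn (M : MarkovMartingale Ω) (x : ℝ) : ℝ :=
  x - ∫ ω, evalAt M.S M.Sinf (drawdown M.S 1) ω ∂(M.P x)

/-- The assumption that the downward-move probability `a` is locally bounded away from zero
above a level `xa`. -/
def ALowerBound (M : MarkovMartingale Ω) (xa : ℝ) : Prop :=
  0 < xa ∧ ∀ y, xa < y → ∃ c > (0 : ℝ), ∀ x ∈ Set.Icc xa y, c ≤ M.a x

end MarkovMartingale

end

namespace MarkovMartingale

section UpPath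

/-- The state reached from `y` by an upward move. -/
noncomputable def upStep (af bf : ℝ → ℝ) (y : ℝ) : ℝ := (1 - bf y) * y / (1 - af y)

/-- The state reached from `y` by a downward move. -/
noncomputable def dnStep (af bf : ℝ → ℝ) (y : ℝ) : ℝ := bf y * y / af y

/-- The state reached from `y` after `j` consecutive upward moves. -/
noncomputable def upPath (af bf : ℝ → ℝ) (y : ℝ) (j : ℕ) : ℝ := (upStep af bf)^[j] y

/-- The fraction of the initial mass carried by `j` consecutive upward moves from `y`. -/
noncomputable def survival (af bf : ℝ → ℝ) (y : ℝ) (j : ℕ) : ℝ :=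
  ∏ i ∈ Finset.range j, (1 - bf (upPath af bf y i))

/-- The mean of the process at its first drawdown, started from `y`. -/
noncomputable def residual (af bf : ℝ → ℝ) (y : ℝ) : ℝ :=
  open Classical in
  if BddAbove (range (upPath af bf y)) then y else y * (1 - ⨅ j, survival af bf y j)

variable {af bf : ℝ → ℝ} {y : ℝ}

@[simp] lemma upPath_zero : upPath af bf y 0 = y := rfl

lemma upPath_succ (j : ℕ) : upPath af bf y (j + 1) = upStep af bf (upPath af bf y j) :=
  Function.iterate_succ_apply' _ _ _

lemma upPath_add (j k : ℕ) :
    upPath af bf y (j + k) = upPath af bf (upPath af bf y j) k := by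
  rw [add_comm]
  exact Function.iterate_add_apply _ _ _ _

lemma survival_succ (j : ℕ) :
    survival af bf y (j + 1) = survival af bf y j * (1 - bf (upPath af bf y j)) :=
  Finset.prod_range_succ _ _

@[simp] lemma survival_zero : survival af bf y 0 = 1 := rfl

variable (hab : ∀ x : ℝ, 0 < x → 0 ≤ bf x ∧ bf x < af x ∧ af x < 1)

include hab

lemma lt_upStep (hy : 0 < y) : y < upStep af bf y := by
  obtain ⟨h0, h1, h2⟩ := hab y hy
  rw [upStep, lt_div_iff₀ (by linarith)]
  nlinarith

lemma dnStep_lt (hy : 0 < y) : dnStep af bf y < y := by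
  obtain ⟨h0, h1, h2⟩ := hab y hy
  rw [dnStep, div_lt_iff₀ (by linarith)]
  nlinarith

lemma dnStep_nonneg (hy : 0 < y) : 0 ≤ dnStep af bf y := by
  obtain ⟨h0, h1, h2⟩ := hab y hy
  have : 0 ≤ af y := by linarith
  unfold dnStep
  positivity

lemma upPath_pos (hy : 0 < y) (j : ℕ) : 0 < upPath af bf y j := by
  induction j with
  | zero => exact hy
  | succ j ih => rw [upPath_succ]; exact ih.trans (lt_upStep hab ih)

lemma upPath_lt_succ (hy : 0 < y) (j : ℕ) : upPath af bf y j < upPath af bf y (j + 1) := by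
  rw [upPath_succ]; exact lt_upStep hab (upPath_pos hab hy j)

lemma upPath_strictMono (hy : 0 < y) : StrictMono (upPath af bf y) :=
  strictMono_nat_of_lt_succ (upPath_lt_succ hab hy)

lemma bf_upPath_mem (hy : 0 < y) (j : ℕ) :
    0 ≤ bf (upPath af bf y j) ∧ bf (upPath af bf y j) < 1 := by
  obtain ⟨h0, h1, h2⟩ := hab _ (upPath_pos hab hy j)
  exact ⟨h0, h1.trans h2⟩

lemma survival_pos (hy : 0 < y) (j : ℕ) : 0 < survival af bf y j :=
  Finset.prod_pos fun i _ => sub_pos.2 (bf_upPath_mem hab hy i).2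

lemma survival_antitone (hy : 0 < y) : Antitone (survival af bf y) :=
  antitone_nat_of_succ_le fun j => by
    rw [survival_succ]
    exact mul_le_of_le_one_right (survival_pos hab hy j).le
      (by linarith [(bf_upPath_mem hab hy j).1])

lemma bddBelow_survival (hy : 0 < y) : BddBelow (range (survival af bf y)) :=
  ⟨0, by rintro _ ⟨j, rfl⟩; exact (survival_pos hab hy j).le⟩

lemma tendsto_survival (hy : 0 < y) :
    Tendsto (survival af bf y) atTop (nhds (⨅ j, survival af bf y j)) :=
  tendsto_atTop_ciInf (survival_antitone hab hy) (bddBelow_survival hab hy)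

lemma iInf_survival_nonneg (hy : 0 < y) : 0 ≤ ⨅ j, survival af bf y j :=
  le_ciInf fun j => (survival_pos hab hy j).le

lemma iInf_survival_le_one (hy : 0 < y) : ⨅ j, survival af bf y j ≤ 1 :=
  ciInf_le (bddBelow_survival hab hy) 0

lemma residual_le (hy : 0 < y) : residual af bf y ≤ y := by
  unfold residual
  split_ifs
  · exact le_rfl
  · nlinarith [iInf_survival_nonneg hab hy]

lemma survival_le_exp (hy : 0 < y) (j : ℕ) :
    survival af bf y j ≤ Real.exp (-∑ i ∈ Finset.range j, bf (upPath af bf y i)) := by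
  rw [← Finset.sum_neg_distrib, Real.exp_sum]
  refine Finset.prod_le_prod (fun i _ => sub_nonneg.2 (bf_upPath_mem hab hy i).2.le)
    fun i _ => ?_
  linarith [Real.add_one_le_exp (-bf (upPath af bf y i))]

lemma iInf_survival_eq_zero_of_not_summable (hy : 0 < y)
    (h : ¬ Summable fun i => bf (upPath af bf y i)) : ⨅ j, survival af bf y j = 0 := by
  have hdiv := (not_summable_iff_tendsto_nat_atTop_of_nonneg
    fun i => (bf_upPath_mem hab hy i).1).1 h
  refine tendsto_nhds_unique (tendsto_survival hab hy) ?_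
  exact squeeze_zero (fun j => (survival_pos hab hy j).le) (survival_le_exp hab hy)
    (Real.tendsto_exp_neg_atTop_nhds_zero.comp hdiv)

lemma one_sub_sum_le_survival (hy : 0 < y) (j : ℕ) :
    1 - ∑ i ∈ Finset.range j, bf (upPath af bf y i) ≤ survival af bf y j := by
  induction j with
  | zero => simp
  | succ j ih =>
    rw [survival_succ, Finset.sum_range_succ]
    have h1 : survival af bf y j ≤ 1 := survival_antitone hab hy (Nat.zero_le j)
    nlinarith [(bf_upPath_mem hab hy j).1]

omit hab in
lemma survival_add (j k : ℕ) :
    survival af bf y (j + k) = survival af bf y j * survival af bf (upPath af bf y j) k := by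
  simp only [survival, Finset.prod_range_add, upPath_add]

lemma iInf_survival_pos_of_summable (hy : 0 < y)
    (h : Summable fun i => bf (upPath af bf y i)) : 0 < ⨅ j, survival af bf y j := by
  obtain ⟨J, hJ⟩ := ((tendsto_sum_nat_add fun i => bf (upPath af bf y i)).eventually_lt_const
    (show (0 : ℝ) < 1 / 2 by norm_num)).exists
  have hyJ := upPath_pos hab hy J
  have hpos := survival_pos hab hy J
  refine lt_of_lt_of_le (half_pos hpos) (le_ciInf fun j => ?_)
  refine le_trans ?_ (survival_antitone hab hy (Nat.le_add_left j J))
  rw [survival_add]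
  have h1 := one_sub_sum_le_survival hab hyJ j
  have h2 : ∑ i ∈ Finset.range j, bf (upPath af bf (upPath af bf y J) i) ≤ 1 / 2 := by
    refine le_trans (Summable.sum_le_tsum (L := SummationFilter.unconditional ℕ) _
      (fun i _ => (bf_upPath_mem hab hyJ i).1) ?_) ?_
    · simpa only [← upPath_add, add_comm] using (summable_nat_add_iff J).2 h
    · simpa only [← upPath_add, add_comm] using hJ.le
  nlinarith

variable {xb : ℝ} (hxb : 0 < xb) (hmono : AntitoneOn bf (Set.Ici xb))

include hxb hmono

omit hab in
lemma antitoneOn_comp_exp : AntitoneOn (fun u => bf (Real.exp u)) (Set.Ici (Real.log xb)) := by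
  intro u hu v hv huv
  have key : ∀ w ∈ Set.Ici (Real.log xb), Real.exp w ∈ Set.Ici xb := fun w hw =>
    (Real.log_le_iff_le_exp hxb).1 hw
  exact hmono (key u hu) (key v hv) (Real.exp_le_exp.2 huv)

lemma integrableOn_of_summable (hlimsup : ∃ c < (1 : ℝ), ∀ᶠ x in atTop, af x ≤ c)
    (hy : 0 < y) (hunb : ¬ BddAbove (range (upPath af bf y)))
    (h : Summable fun i => bf (upPath af bf y i)) :
    IntegrableOn (fun u => bf (Real.exp u)) (Set.Ici (Real.log xb)) := by
  obtain ⟨c, hc1, hc⟩ := hlimsup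
  have hanti := antitoneOn_comp_exp hxb hmono
  have htop : Tendsto (upPath af bf y) atTop atTop :=
    tendsto_atTop_atTop_of_monotone (upPath_strictMono hab hy).monotone fun b => by
      by_contra! hcon
      exact hunb ⟨b, by rintro _ ⟨j, rfl⟩; exact (hcon j).le⟩
  obtain ⟨J, hJ⟩ := (htop.eventually (hc.and (eventually_ge_atTop xb))).exists_forall_of_atTop
  set z : ℕ → ℝ := fun j => Real.log (upPath af bf y (J + j)) with hz
  have hzpos : ∀ j, 0 < upPath af bf y (J + j) := fun j => upPath_pos hab hy _
  have hzmono : Monotone z := fun i j hij =>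
    Real.log_le_log (hzpos i) ((upPath_strictMono hab hy).monotone (by lia))
  have hzb : ∀ j, Real.log xb ≤ z j := fun j => Real.log_le_log hxb (hJ _ (by lia)).2
  have hint : ∀ p q, Real.log xb ≤ p → p ≤ q →
      IntervalIntegrable (fun u => bf (Real.exp u)) volume p q := fun p q hp hpq =>
    (hanti.mono (by rw [uIcc_of_le hpq]; exact fun w hw => hp.trans hw.1)).intervalIntegrable
  have hstep : ∀ j, z (j + 1) - z j ≤ Real.log (1 / (1 - c)) := fun j => by
    have hj := hJ (J + j) (by lia)
    obtain ⟨h0, h1, h2⟩ := hab _ (hzpos j)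
    simp only [hz]
    rw [← Real.log_div (hzpos _).ne' (hzpos _).ne']
    refine Real.log_le_log (div_pos (hzpos _) (hzpos _)) ?_
    rw [← add_assoc, upPath_succ, upStep, div_div, mul_comm (1 - af _), ← div_div,
      mul_div_assoc, div_self (hzpos j).ne', mul_one]
    exact div_le_div₀ zero_le_one (by linarith) (by linarith) (by linarith [hj.1])
  have hL : 0 ≤ Real.log (1 / (1 - c)) :=
    (sub_nonneg.2 (hzmono (Nat.le_succ 0))).trans (hstep 0)
  have hpiece : ∀ j, ∫ u in z j..z (j + 1), ‖bf (Real.exp u)‖ ≤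
      Real.log (1 / (1 - c)) * bf (upPath af bf y (J + j)) := fun j => by
    have hle := hzmono (Nat.le_succ j)
    calc ∫ u in z j..z (j + 1), ‖bf (Real.exp u)‖
        ≤ ∫ u in z j..z (j + 1), bf (upPath af bf y (J + j)) := by
          refine intervalIntegral.integral_mono_on hle (hint _ _ (hzb j) hle).norm
            intervalIntegrable_const fun u hu => ?_
          rw [Real.norm_of_nonneg (hab _ (Real.exp_pos u)).1]
          have := hanti (hzb j) ((hzb j).trans hu.1) hu.1
          simpa only [hz, Real.exp_log (hzpos j)] using this
      _ = (z (j + 1) - z j) * bf (upPath af bf y (J + j)) := by simp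
      _ ≤ _ := mul_le_mul_of_nonneg_right (hstep j) (bf_upPath_mem hab hy _).1
  have hsum : Summable fun j => bf (upPath af bf y (J + j)) := by
    simpa only [add_comm] using (summable_nat_add_iff J).2 h
  have htail : IntegrableOn (fun u => bf (Real.exp u)) (Set.Ioi (z 0)) := by
    refine integrableOn_Ioi_of_intervalIntegral_norm_bounded (b := z) (l := atTop)
      (Real.log (1 / (1 - c)) * ∑' j, bf (upPath af bf y (J + j))) _ (fun j => ?_) ?_
      (Eventually.of_forall fun N => ?_)
    · rw [← intervalIntegrable_iff_integrableOn_Ioc_of_le (hzmono (Nat.zero_le j))]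
      exact hint _ _ (hzb 0) (hzmono (Nat.zero_le j))
    · exact Real.tendsto_log_atTop.comp (htop.comp (tendsto_add_atTop_nat J |>.congr fun j =>
        add_comm j J))
    · rw [← intervalIntegral.sum_integral_adjacent_intervals
        fun k _ => (hint _ _ (hzb k) (hzmono (Nat.le_succ k))).norm]
      refine (Finset.sum_le_sum fun j _ => hpiece j).trans ?_
      rw [← Finset.mul_sum]
      exact mul_le_mul_of_nonneg_left
        (hsum.sum_le_tsum _ fun i _ => (bf_upPath_mem hab hy _).1) hL
  have hhead : IntegrableOn (fun u => bf (Real.exp u)) (Set.Icc (Real.log xb) (z 0)) :=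
    (hanti.mono fun w hw => hw.1).integrableOn_isCompact isCompact_Icc
  exact (hhead.union htail).mono_set fun w hw => (le_or_gt w (z 0)).imp (fun h => ⟨hw, h⟩) id

omit hab hmono hxb in
lemma eventually_le_of_antitoneOn_of_integrableOn {f : ℝ → ℝ} {p : ℝ}
    (hf : AntitoneOn f (Set.Ici p)) (hi : IntegrableOn f (Set.Ici p))
    {ε : ℝ} (hε : 0 < ε) : ∀ᶠ u in atTop, f u ≤ ε := by
  by_contra hcon
  have hlow : ∀ u ∈ Set.Ici p, ε ≤ f u := fun u hu => by
    obtain ⟨v, huv, hv⟩ := (Filter.not_eventually.1 hcon).forall_exists_of_atTop u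
    exact (not_le.1 hv).le.trans (hf hu (le_trans hu huv) huv)
  have hconst : IntegrableOn (fun _ : ℝ => ε) (Set.Ici p) := by
    refine Integrable.mono' hi aestronglyMeasurable_const ?_
    filter_upwards [ae_restrict_mem measurableSet_Ici] with u hu
    rw [Real.norm_of_nonneg hε.le]
    exact hlow u hu
  rw [integrableOn_const_iff] at hconst
  simp [hε.ne'] at hconst

/-- Once an upward path exceeds a suitable level, it escapes to infinity while keeping a
positive fraction of its mass. -/
lemma exists_escape_level (hliminf : ∃ c > (0 : ℝ), ∀ᶠ x in atTop, c ≤ af x)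
    (h : IntegrableOn (fun u => bf (Real.exp u)) (Set.Ici (Real.log xb))) :
    ∃ C, ∀ y, 0 < y → ∀ j, C < upPath af bf y j → residual af bf y < y := by
  obtain ⟨c, hc0, hc⟩ := hliminf
  have hanti := antitoneOn_comp_exp hxb hmono
  have hsmall : ∀ᶠ x in atTop, bf x ≤ c / 2 := by
    filter_upwards [Real.tendsto_log_atTop.eventually
      (eventually_le_of_antitoneOn_of_integrableOn hanti h (half_pos hc0)),
      eventually_gt_atTop 0] with x hx hx0
    rwa [Real.exp_log hx0] at hx
  obtain ⟨C, hC⟩ := (hc.and (hsmall.and (eventually_ge_atTop xb))).exists_forall_of_atTop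
  refine ⟨C, fun y hy J hJ => ?_⟩
  have hw : ∀ j, C ≤ upPath af bf y (J + j) := fun j =>
    hJ.le.trans ((upPath_strictMono hab hy).monotone (Nat.le_add_right _ _))
  have hwpos : ∀ j, 0 < upPath af bf y (J + j) := fun j => upPath_pos hab hy _
  have hc1 : c < 1 := (hC _ (hw 0)).1.trans_lt (hab _ (hwpos 0)).2.2
  set r : ℝ := (1 - c / 2) / (1 - c) with hr
  have hr1 : 1 < r := (one_lt_div (by linarith)).2 (by linarith)
  set z : ℕ → ℝ := fun j => Real.log (upPath af bf y (J + j)) with hz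
  have hδ : 0 < Real.log r := Real.log_pos hr1
  have hstep : ∀ j, Real.log r ≤ z (j + 1) - z j := fun j => by
    obtain ⟨ha, hb, -⟩ := hC _ (hw j)
    obtain ⟨h0, h1, h2⟩ := hab _ (hwpos j)
    simp only [hz]
    rw [← Real.log_div (hwpos _).ne' (hwpos _).ne']
    refine Real.log_le_log (by linarith) ?_
    rw [← add_assoc, upPath_succ, upStep, div_div, mul_comm (1 - af _), ← div_div,
      mul_div_assoc, div_self (hwpos j).ne', mul_one]
    exact div_le_div₀ (by linarith) (by linarith) (by linarith) (by linarith)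
  have hzmono : Monotone z := monotone_nat_of_le_succ fun j => by linarith [hstep j]
  have hzlow : ∀ j : ℕ, z 0 + j * Real.log r ≤ z j := fun j => by
    induction j with
    | zero => simp
    | succ j ih => push_cast; linarith [hstep j]
  have hunb : ¬ BddAbove (range (upPath af bf y)) := by
    rintro ⟨D, hD⟩
    obtain ⟨j, hj⟩ := exists_nat_gt ((Real.log D - z 0) / Real.log r)
    rw [div_lt_iff₀ hδ] at hj
    have h1 : z j ≤ Real.log D := Real.log_le_log (hwpos j) (hD ⟨_, rfl⟩)
    linarith [hzlow j]
  have hzb : ∀ j, Real.log xb ≤ z j := fun j => Real.log_le_log hxb (hC _ (hw j)).2.2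
  have hint : ∀ p q, Real.log xb ≤ p → p ≤ q →
      IntervalIntegrable (fun u => bf (Real.exp u)) volume p q := fun p q hp hpq =>
    (hanti.mono (by rw [uIcc_of_le hpq]; exact fun w hw => hp.trans hw.1)).intervalIntegrable
  have hpiece : ∀ j, Real.log r * bf (upPath af bf y (J + (j + 1))) ≤
      ∫ u in z j..z (j + 1), bf (Real.exp u) := fun j => by
    have hle := hzmono (Nat.le_succ j)
    calc Real.log r * bf (upPath af bf y (J + (j + 1)))
        ≤ (z (j + 1) - z j) * bf (upPath af bf y (J + (j + 1))) :=
          mul_le_mul_of_nonneg_right (hstep j) (bf_upPath_mem hab hy _).1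
      _ = ∫ u in z j..z (j + 1), bf (upPath af bf y (J + (j + 1))) := by simp
      _ ≤ _ := by
          refine intervalIntegral.integral_mono_on hle intervalIntegrable_const
            (hint _ _ (hzb j) hle) fun u hu => ?_
          have := hanti ((hzb j).trans hu.1) (hzb (j + 1)) hu.2
          simpa only [hz, Real.exp_log (hwpos _)] using this
  have hsum : Summable fun j => bf (upPath af bf y (J + (j + 1))) := by
    refine summable_of_sum_range_le
      (c := (∫ u in Set.Ici (Real.log xb), bf (Real.exp u)) / Real.log r)
      (fun j => (bf_upPath_mem hab hy _).1) fun N => ?_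
    rw [le_div_iff₀' hδ, Finset.mul_sum]
    refine (Finset.sum_le_sum fun j _ => hpiece j).trans ?_
    rw [intervalIntegral.sum_integral_adjacent_intervals
        fun k _ => hint _ _ (hzb k) (hzmono (Nat.le_succ k)),
      intervalIntegral.integral_of_le (hzmono (Nat.zero_le N))]
    exact setIntegral_mono_set h (Eventually.of_forall fun u => (hab _ (Real.exp_pos u)).1)
      (Eventually.of_forall fun u hu => (hzb 0).trans hu.1.le)
  have hpos := iInf_survival_pos_of_summable hab hy
    ((summable_nat_add_iff (J + 1)).1 (hsum.congr fun j => by congr 2; lia))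
  rw [residual, if_neg hunb]
  nlinarith

end UpPath

section Drawdown

variable {Ω : Type*} {S : ℕ → Ω → ℝ} {ω : Ω}

lemma drawdownAfter_eq_coe_iff {m n : ℕ} :
    drawdownAfter S m ω = n ↔
      m < n ∧ S n ω < S (n - 1) ω ∧ ∀ i, m < i → i < n → S (i - 1) ω ≤ S i ω := by
  set D : Set ℕ∞ := {j : ℕ∞ | (m : ℕ∞) < j ∧ ∃ n : ℕ, j = (n : ℕ∞) ∧ S n ω < S (n - 1) ω}
    with hD
  have hmem : ∀ i : ℕ, (i : ℕ∞) ∈ D ↔ m < i ∧ S i ω < S (i - 1) ω := fun i => by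
    simp [hD]
  change sInf D = n ↔ _
  constructor
  · intro h
    have hne : D.Nonempty := by
      by_contra hne
      rw [not_nonempty_iff_eq_empty.1 hne, sInf_empty] at h
      exact ENat.top_ne_natCast n h
    have hn : (n : ℕ∞) ∈ D := h ▸ csInf_mem hne
    refine ⟨((hmem n).1 hn).1, ((hmem n).1 hn).2, fun i hmi hin => ?_⟩
    by_contra! hlt
    have hle : sInf D ≤ i := sInf_le ((hmem i).2 ⟨hmi, hlt⟩)
    rw [h, Nat.cast_le] at hle
    lia
  · rintro ⟨hmn, hlt, hup⟩
    refine le_antisymm (sInf_le ((hmem n).2 ⟨hmn, hlt⟩)) (le_sInf ?_)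
    rintro j ⟨hj, i, rfl, hi⟩
    rw [Nat.cast_le]
    by_contra! hin
    exact absurd hi (hup i (Nat.cast_lt.1 hj) hin).not_gt

lemma drawdownAfter_eq_top {m : ℕ} (h : ∀ i, m < i → S (i - 1) ω ≤ S i ω) :
    drawdownAfter S m ω = ⊤ := by
  induction hd : drawdownAfter S m ω using ENat.recTopCoe with
  | top => rfl
  | coe n =>
    obtain ⟨h1, h2, -⟩ := drawdownAfter_eq_coe_iff.1 hd
    exact absurd h2 (h n h1).not_gt

lemma drawdown_succ_of_eq_coe {k n : ℕ} (h : drawdown S k ω = n) :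
    drawdown S (k + 1) ω = drawdownAfter S n ω := by
  simp only [drawdown, drawdownAfter, h]

lemma drawdown_succ_of_eq_top {k : ℕ} (h : drawdown S k ω = ⊤) :
    drawdown S (k + 1) ω = ⊤ := by
  simp [drawdown, h]

lemma drawdown_succ_eq_coe_iff {k n : ℕ} :
    drawdown S (k + 1) ω = n ↔
      ∃ m : ℕ, drawdown S k ω = m ∧ m < n ∧ S n ω < S (n - 1) ω ∧
        ∀ i, m < i → i < n → S (i - 1) ω ≤ S i ω := by
  constructor
  · intro h
    induction hd : drawdown S k ω using ENat.recTopCoe with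
    | top => rw [drawdown_succ_of_eq_top hd] at h; exact absurd h (ENat.top_ne_natCast n)
    | coe m =>
      rw [drawdown_succ_of_eq_coe hd] at h
      exact ⟨m, rfl, drawdownAfter_eq_coe_iff.1 h⟩
  · rintro ⟨m, hm, h⟩
    rw [drawdown_succ_of_eq_coe hm]
    exact drawdownAfter_eq_coe_iff.2 h

lemma evalAt_of_eq_top {Sinf : Ω → ℝ} {τ : Ω → ℕ∞} (h : τ ω = ⊤) :
    evalAt S Sinf τ ω = Sinf ω := if_pos h

lemma evalAt_of_eq_coe {Sinf : Ω → ℝ} {τ : Ω → ℕ∞} {n : ℕ} (h : τ ω = n) :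
    evalAt S Sinf τ ω = S n ω := by
  simp [evalAt, h]

variable [m0 : MeasurableSpace Ω] {F : Filtration ℕ m0}

lemma measurableSet_drawdown_eq_coe (hS : StronglyAdapted F S) (k n : ℕ) :
    MeasurableSet[F n] {ω | drawdown S k ω = n} := by
  induction k generalizing n with
  | zero =>
    simp [drawdown]
  | succ k ih =>
    have hmeas : ∀ i, i ≤ n → Measurable[F n] (S i) := fun i hi =>
      ((hS i).mono (F.mono hi)).measurable
    have heq : {ω | drawdown S (k + 1) ω = n} =
        ⋃ m : ℕ, ⋃ (_ : m < n), {ω | drawdown S k ω = m} ∩ {ω | S n ω < S (n - 1) ω} ∩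
          ⋂ i, ⋂ (_ : m < i), ⋂ (_ : i < n), {ω | S (i - 1) ω ≤ S i ω} := by
      ext ω
      simp only [mem_ofPred_eq, drawdown_succ_eq_coe_iff, mem_iUnion, mem_inter_iff, mem_iInter]
      constructor
      · rintro ⟨m, h1, h2, h3, h4⟩
        exact ⟨m, h2, ⟨h1, h3⟩, h4⟩
      · rintro ⟨m, h2, ⟨h1, h3⟩, h4⟩
        exact ⟨m, h1, h2, h3, h4⟩
    rw [heq]
    refine MeasurableSet.iUnion fun m => MeasurableSet.iUnion fun hm =>
      ((F.mono hm.le _ (ih m)).inter ?_).inter (MeasurableSet.iInter fun i =>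
        MeasurableSet.iInter fun _ => MeasurableSet.iInter fun hi => ?_)
    · exact measurableSet_lt (hmeas n le_rfl) (hmeas (n - 1) (Nat.sub_le _ _))
    · exact measurableSet_le (hmeas _ (by lia)) (hmeas _ hi.le)

lemma measurable_drawdown (hS : StronglyAdapted F S) (k : ℕ) : Measurable (drawdown S k) := by
  have hcoe : ∀ n : ℕ, MeasurableSet (drawdown S k ⁻¹' {(n : ℕ∞)}) := fun n =>
    F.le n _ (measurableSet_drawdown_eq_coe hS k n)
  refine measurable_to_countable' fun j => ?_
  induction j using ENat.recTopCoe with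
  | coe n => exact hcoe n
  | top =>
    have : drawdown S k ⁻¹' {⊤} = (⋃ n : ℕ, drawdown S k ⁻¹' {(n : ℕ∞)})ᶜ := by
      ext ω
      simp only [mem_preimage, mem_singleton_iff, mem_compl_iff, mem_iUnion, not_exists]
      constructor
      · intro h n
        rw [h]
        exact ENat.top_ne_natCast n
      · intro h
        by_contra hne
        exact h _ (ENat.natCast_toNat hne).symm
    rw [this]
    exact (MeasurableSet.iUnion hcoe).compl

lemma aemeasurable_evalAt {μ : Measure Ω} (hS : StronglyAdapted F S) {Sinf : Ω → ℝ}
    (hSinf : AEMeasurable Sinf μ) {τ : Ω → ℕ∞} (hτ : Measurable τ) :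
    AEMeasurable (evalAt S Sinf τ) μ := by
  have hSm : ∀ n, Measurable (S n) := fun n => ((hS n).mono (F.le n)).measurable
  refine ⟨evalAt S (hSinf.mk Sinf) τ, ?_, ?_⟩
  · refine Measurable.ite (hτ (measurableSet_singleton ⊤)) hSinf.measurable_mk ?_
    have huncurry : Measurable fun p : ℕ × Ω => S p.1 p.2 :=
      measurable_from_prod_countable_right hSm
    exact huncurry.comp (((measurable_of_countable ENat.toNat).comp hτ).prodMk measurable_id)
  · filter_upwards [hSinf.ae_eq_mk] with ω hω
    simp only [evalAt, hω]

end Drawdown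

section Binary

variable {Ω : Type*} [MeasurableSpace Ω] (M : MarkovMartingale Ω) {af bf : ℝ → ℝ}
  (hker : ∀ x : ℝ, 0 < x →
    M.K x = ENNReal.ofReal (af x) • Measure.dirac (bf x * x / af x) +
      ENNReal.ofReal (1 - af x) • Measure.dirac ((1 - bf x) * x / (1 - af x)))
  (hab : ∀ x : ℝ, 0 < x → 0 ≤ bf x ∧ bf x < af x ∧ af x < 1)

lemma measurable_S {x : ℝ} (hx : 0 < x) (n : ℕ) : Measurable[M.F n] (M.S n) :=
  ((M.mart x hx).1 n).measurable

lemma measure_inter_step {x y z : ℝ} (hx : 0 < x) {n : ℕ} {A : Set Ω}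
    (hA : MeasurableSet[M.F n] A) (hAy : ∀ ω ∈ A, M.S n ω = y) :
    M.P x (A ∩ {ω | M.S (n + 1) ω = z}) = M.P x A * M.K y {z} := by
  have := M.prob x hx
  have := M.markov
  have hz : MeasurableSet {ω | M.S (n + 1) ω = z} :=
    (M.F.le (n + 1)) _ (M.measurable_S hx (n + 1) (measurableSet_singleton z))
  set g : ℝ → ℝ := ({z} : Set ℝ).indicator 1 with hg
  have hgm : Measurable g := measurable_one.indicator (measurableSet_singleton z)
  have hgS : (fun ω => g (M.S (n + 1) ω)) = {ω | M.S (n + 1) ω = z}.indicator 1 := by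
    ext ω
    simp only [hg, indicator_apply, mem_singleton_iff, mem_ofPred_eq, Pi.one_apply]
  have hint : Integrable (fun ω => g (M.S (n + 1) ω)) (M.P x) := by
    rw [hgS]
    exact (integrable_const (1 : ℝ)).indicator hz
  have hce := setIntegral_condExp (M.F.le n) hint hA
  have hlhs : ∫ ω in A, ((M.P x)[fun ω => g (M.S (n + 1) ω) | M.F n]) ω ∂(M.P x) =
      (M.P x).real A * (M.K y).real {z} := by
    rw [setIntegral_congr_ae (g := fun _ => (M.K y).real {z}) (M.F.le n _ hA)]
    · simp
    · filter_upwards [M.step x hx n g hgm ⟨1, fun y => by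
        by_cases h : y = z <;> simp [hg, h]⟩] with ω hω hωA
      rw [hω, hAy ω hωA, hg, integral_indicator_one (measurableSet_singleton z)]
  rw [hlhs, hgS, setIntegral_indicator hz] at hce
  simp only [Pi.one_apply, integral_const, smul_eq_mul, mul_one, measureReal_restrict_apply_univ]
    at hce
  rw [← ENNReal.toReal_eq_toReal_iff' (measure_ne_top _ _)
    (ENNReal.mul_ne_top (measure_ne_top _ _) (measure_ne_top _ _)), ENNReal.toReal_mul]
  exact hce.symm

include hker hab

lemma kernel_upStep {y : ℝ} (hy : 0 < y) :
    M.K y {upStep af bf y} = ENNReal.ofReal (1 - af y) := by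
  have h : dnStep af bf y ≠ upStep af bf y :=
    ((dnStep_lt hab hy).trans (lt_upStep hab hy)).ne
  rw [hker y hy]
  change (ENNReal.ofReal (af y) • Measure.dirac (dnStep af bf y) +
    ENNReal.ofReal (1 - af y) • Measure.dirac (upStep af bf y)) {upStep af bf y} = _
  simp [h]

lemma kernel_dnStep {y : ℝ} (hy : 0 < y) :
    M.K y {dnStep af bf y} = ENNReal.ofReal (af y) := by
  have h : upStep af bf y ≠ dnStep af bf y :=
    ((dnStep_lt hab hy).trans (lt_upStep hab hy)).ne'
  rw [hker y hy]
  change (ENNReal.ofReal (af y) • Measure.dirac (dnStep af bf y) +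
    ENNReal.ofReal (1 - af y) • Measure.dirac (upStep af bf y)) {dnStep af bf y} = _
  simp [h]

lemma dnStep_pos {y : ℝ} (hy : 0 < y) : 0 < dnStep af bf y := by
  by_contra! h
  have h1 : M.K y {dnStep af bf y} = 0 :=
    measure_mono_null (singleton_subset_iff.2 h) (M.kernel_pos y hy)
  rw [kernel_dnStep M hker hab hy, ENNReal.ofReal_eq_zero] at h1
  linarith [(hab y hy).1, (hab y hy).2.1]

lemma ae_step_of_eq {x y : ℝ} (hx : 0 < x) (hy : 0 < y) (n : ℕ) :
    ∀ᵐ ω ∂M.P x, M.S n ω = y →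
      M.S (n + 1) ω = upStep af bf y ∨ M.S (n + 1) ω = dnStep af bf y := by
  have := M.prob x hx
  set A : Set Ω := {ω | M.S n ω = y} with hA
  have hAm : MeasurableSet[M.F n] A := M.measurable_S hx n (measurableSet_singleton y)
  have hm : ∀ z, MeasurableSet {ω | M.S (n + 1) ω = z} := fun z =>
    (M.F.le (n + 1)) _ (M.measurable_S hx (n + 1) (measurableSet_singleton z))
  set B : Set Ω := {ω | M.S (n + 1) ω = upStep af bf y} ∪ {ω | M.S (n + 1) ω = dnStep af bf y}
  have hB : MeasurableSet B := (hm _).union (hm _)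
  have hAB : M.P x (A ∩ B) = M.P x A := by
    rw [inter_union_distrib_left, measure_union _ ((M.F.le n _ hAm).inter (hm _)),
      M.measure_inter_step hx hAm fun _ h => h, M.measure_inter_step hx hAm fun _ h => h,
      kernel_upStep M hker hab hy, kernel_dnStep M hker hab hy, ← mul_add,
      ← ENNReal.ofReal_add (by linarith [(hab y hy).2.2])
        (by linarith [(hab y hy).1, (hab y hy).2.1])]
    · simp
    · refine disjoint_left.2 fun ω h1 h2 => ?_
      exact ((dnStep_lt hab hy).trans (lt_upStep hab hy)).ne (h2.2.symm.trans h1.2)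
  have hdiff : M.P x (A \ B) = 0 := by
    have := measure_inter_add_sdiff (μ := M.P x) A hB
    rw [hAB] at this
    exact (ENNReal.add_right_inj (measure_ne_top _ _)).1 (this.trans (add_zero _).symm)
  rw [ae_iff]
  convert hdiff using 2
  ext ω
  simp [A, B]

omit hker hab in
/-- The states which the chain started from `x` can occupy after `n` moves. -/
def reach (af bf : ℝ → ℝ) (x : ℝ) : ℕ → Set ℝ
  | 0 => {x}
  | n + 1 => upStep af bf '' reach af bf x n ∪ dnStep af bf '' reach af bf x n

omit hker hab in
lemma countable_reach (x : ℝ) (n : ℕ) : (reach af bf x n).Countable := by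
  induction n with
  | zero => exact countable_singleton x
  | succ n ih => exact (ih.image _).union (ih.image _)

lemma reach_pos {x : ℝ} (hx : 0 < x) (n : ℕ) : ∀ y ∈ reach af bf x n, 0 < y := by
  induction n with
  | zero => rintro y rfl; exact hx
  | succ n ih =>
    rintro _ (⟨y, hy, rfl⟩ | ⟨y, hy, rfl⟩)
    · exact (ih y hy).trans (lt_upStep hab (ih y hy))
    · exact dnStep_pos M hker hab (ih y hy)

lemma ae_mem_reach {x : ℝ} (hx : 0 < x) (n : ℕ) :
    ∀ᵐ ω ∂M.P x, M.S n ω ∈ reach af bf x n := by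
  induction n with
  | zero => exact M.start x hx
  | succ n ih =>
    have hall : ∀ᵐ ω ∂M.P x, ∀ y ∈ reach af bf x n, M.S n ω = y →
        M.S (n + 1) ω = upStep af bf y ∨ M.S (n + 1) ω = dnStep af bf y :=
      (ae_ball_iff (countable_reach x n)).2 fun y hy =>
        ae_step_of_eq M hker hab hx (reach_pos M hker hab hx n y hy) n
    filter_upwards [ih, hall] with ω hω hstep
    rcases hstep _ hω rfl with h | h
    · exact Or.inl ⟨_, hω, h.symm⟩
    · exact Or.inr ⟨_, hω, h.symm⟩

lemma ae_step {x : ℝ} (hx : 0 < x) :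
    ∀ᵐ ω ∂M.P x, ∀ n, M.S (n + 1) ω = upStep af bf (M.S n ω) ∨
      M.S (n + 1) ω = dnStep af bf (M.S n ω) := by
  refine ae_all_iff.2 fun n => ?_
  have hall : ∀ᵐ ω ∂M.P x, ∀ y ∈ reach af bf x n, M.S n ω = y →
      M.S (n + 1) ω = upStep af bf y ∨ M.S (n + 1) ω = dnStep af bf y :=
    (ae_ball_iff (countable_reach x n)).2 fun y hy =>
      ae_step_of_eq M hker hab hx (reach_pos M hker hab hx n y hy) n
  filter_upwards [ae_mem_reach M hker hab hx n, hall] with ω hω hstep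
  exact hstep _ hω rfl

omit hker hab in
/-- The part of `A` on which the chain makes `j` consecutive upward moves from `y` after
time `n`. -/
def upEvent (af bf : ℝ → ℝ) (A : Set Ω) (n : ℕ) (y : ℝ) (j : ℕ) : Set Ω :=
  A ∩ {ω | ∀ i ≤ j, M.S (n + i) ω = upPath af bf y i}

omit hker hab in
lemma upEvent_succ (A : Set Ω) (n : ℕ) (y : ℝ) (j : ℕ) :
    M.upEvent af bf A n y (j + 1) =
      M.upEvent af bf A n y j ∩ {ω | M.S (n + j + 1) ω = upPath af bf y (j + 1)} := by
  ext ω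
  simp only [upEvent, mem_inter_iff, mem_ofPred_eq, and_assoc, and_congr_right_iff]
  intro _
  constructor
  · exact fun h => ⟨fun i hi => h i (by lia), h (j + 1) le_rfl⟩
  · rintro ⟨h1, h2⟩ i hi
    rcases Nat.le_succ_iff.1 hi with h | rfl
    · exact h1 i h
    · exact h2

omit hker hab in
lemma upEvent_antitone (A : Set Ω) (n : ℕ) (y : ℝ) : Antitone (M.upEvent af bf A n y) :=
  antitone_nat_of_succ_le fun j => by
    rw [upEvent_succ]
    exact inter_subset_left

omit hker hab in
lemma measurableSet_upEvent {x : ℝ} (hx : 0 < x) {A : Set Ω} {n : ℕ}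
    (hA : MeasurableSet[M.F n] A) (y : ℝ) (j : ℕ) :
    MeasurableSet[M.F (n + j)] (M.upEvent af bf A n y j) := by
  have heq : {ω | ∀ i ≤ j, M.S (n + i) ω = upPath af bf y i} =
      ⋂ i, ⋂ (_ : i ≤ j), M.S (n + i) ⁻¹' {upPath af bf y i} := by
    ext ω
    simp
  rw [upEvent, heq]
  refine (M.F.mono (Nat.le_add_right n j) _ hA).inter
    (MeasurableSet.iInter fun i => MeasurableSet.iInter fun hi => ?_)
  exact M.F.mono (by lia) _ (M.measurable_S hx (n + i) (measurableSet_singleton _))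

variable {x y : ℝ} {n : ℕ} {A : Set Ω} (hx : 0 < x) (hy : 0 < y)
  (hA : MeasurableSet[M.F n] A) (hAy : ∀ ω ∈ A, M.S n ω = y)

include hx hy hA hAy

omit hker hab hx hy hA in
lemma upEvent_zero : M.upEvent af bf A n y 0 = A := by
  ext ω
  simp only [upEvent, mem_inter_iff, mem_ofPred_eq, and_iff_left_iff_imp]
  intro hω i hi
  obtain rfl : i = 0 := by lia
  exact hAy ω hω

omit hAy in
lemma measure_upEvent_succ (j : ℕ) :
    M.P x (M.upEvent af bf A n y (j + 1)) =
      M.P x (M.upEvent af bf A n y j) * ENNReal.ofReal (1 - af (upPath af bf y j)) := by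
  rw [upEvent_succ, M.measure_inter_step hx (M.measurableSet_upEvent hx hA y j)
    fun ω hω => hω.2 j le_rfl, upPath_succ, kernel_upStep M hker hab (upPath_pos hab hy j)]

lemma ofReal_mul_measure_upEvent (j : ℕ) :
    ENNReal.ofReal (upPath af bf y j) * M.P x (M.upEvent af bf A n y j) =
      ENNReal.ofReal (y * survival af bf y j) * M.P x A := by
  induction j with
  | zero => simp [upEvent_zero M hAy]
  | succ j ih =>
    have hp := upPath_pos hab hy j
    obtain ⟨h0, h1, h2⟩ := hab _ hp
    calc _ = (ENNReal.ofReal (upPath af bf y (j + 1)) *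
            ENNReal.ofReal (1 - af (upPath af bf y j))) *
            M.P x (M.upEvent af bf A n y j) := by
          rw [measure_upEvent_succ M hker hab hx hy hA]; ring
      _ = ENNReal.ofReal (1 - bf (upPath af bf y j)) * (ENNReal.ofReal (upPath af bf y j) *
            M.P x (M.upEvent af bf A n y j)) := by
          rw [← ENNReal.ofReal_mul (upPath_pos hab hy _).le, upPath_succ, upStep,
            div_mul_cancel₀ _ (by linarith), ENNReal.ofReal_mul (by linarith)]
          ring
      _ = _ := by
          rw [ih, survival_succ, ← mul_assoc, ← ENNReal.ofReal_mul (by linarith)]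
          ring_nf

lemma setLIntegral_drawdownAfter_of_dnStep (j : ℕ) :
    ∫⁻ ω in M.upEvent af bf A n y j ∩ {ω | M.S (n + j + 1) ω = dnStep af bf (upPath af bf y j)},
        ENNReal.ofReal (evalAt M.S M.Sinf (drawdownAfter M.S n) ω) ∂M.P x =
      ENNReal.ofReal (y * survival af bf y j - y * survival af bf y (j + 1)) * M.P x A := by
  have hp := upPath_pos hab hy j
  obtain ⟨h0, h1, h2⟩ := hab _ hp
  have hUm := M.measurableSet_upEvent (af := af) (bf := bf) hx hA y j
  have hDm : MeasurableSet (M.upEvent af bf A n y j ∩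
      {ω | M.S (n + j + 1) ω = dnStep af bf (upPath af bf y j)}) :=
    (M.F.le _ _ hUm).inter (M.F.le _ _ (M.measurable_S hx (n + j + 1) (measurableSet_singleton _)))
  rw [setLIntegral_congr_fun (g := fun _ => ENNReal.ofReal (dnStep af bf (upPath af bf y j))) hDm]
  · rw [setLIntegral_const, M.measure_inter_step hx hUm fun ω hω => hω.2 j le_rfl,
      kernel_dnStep M hker hab hp]
    calc _ = ENNReal.ofReal (dnStep af bf (upPath af bf y j)) *
            ENNReal.ofReal (af (upPath af bf y j)) * M.P x (M.upEvent af bf A n y j) := by ring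
      _ = ENNReal.ofReal (bf (upPath af bf y j)) * (ENNReal.ofReal (upPath af bf y j) *
            M.P x (M.upEvent af bf A n y j)) := by
          rw [← ENNReal.ofReal_mul (dnStep_nonneg hab hp), dnStep,
            div_mul_cancel₀ _ (by linarith), ENNReal.ofReal_mul h0]
          ring
      _ = _ := by
          rw [ofReal_mul_measure_upEvent M hker hab hx hy hA hAy, ← mul_assoc,
            ← ENNReal.ofReal_mul h0, survival_succ]
          ring_nf
  · rintro ω ⟨⟨-, hup⟩, hdn⟩
    have hτ : drawdownAfter M.S n ω = ((n + j + 1 : ℕ) : ℕ∞) := by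
      refine drawdownAfter_eq_coe_iff.2 ⟨by lia, ?_, fun i hni hi => ?_⟩
      · rw [Nat.add_sub_cancel, hup j le_rfl, hdn]
        exact dnStep_lt hab hp
      · obtain ⟨l, rfl⟩ : ∃ l, i = n + (l + 1) := ⟨i - n - 1, by lia⟩
        rw [hup (l + 1) (by lia), ← add_assoc, Nat.add_sub_cancel, hup l (by lia)]
        exact (upPath_lt_succ hab hy l).le
    simp only [evalAt_of_eq_coe hτ]
    rw [hdn]

lemma setLIntegral_drawdownAfter_of_up :
    ∫⁻ ω in ⋂ j, M.upEvent af bf A n y j,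
        ENNReal.ofReal (evalAt M.S M.Sinf (drawdownAfter M.S n) ω) ∂M.P x =
      ENNReal.ofReal (residual af bf y - y * (1 - ⨅ j, survival af bf y j)) * M.P x A := by
  have := M.prob x hx
  set U := M.upEvent af bf A n y
  have hUm : ∀ j, MeasurableSet (U j) := fun j =>
    M.F.le _ _ (M.measurableSet_upEvent hx hA y j)
  have hlim : ∀ᵐ ω ∂M.P x, ω ∈ (⋂ j, U j) →
      Tendsto (upPath af bf y) atTop (nhds (M.Sinf ω)) := by
    filter_upwards [M.conv x hx] with ω hω hωU
    refine ((tendsto_add_atTop_iff_nat n).2 hω).congr fun j => ?_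
    rw [add_comm]
    exact (mem_iInter.1 hωU j).2 j le_rfl
  by_cases hbdd : BddAbove (range (upPath af bf y))
  · have htend := tendsto_atTop_ciSup (upPath_strictMono hab hy).monotone hbdd
    set l := ⨆ j, upPath af bf y j
    rw [setLIntegral_congr_fun_ae (g := fun _ => ENNReal.ofReal l) (MeasurableSet.iInter hUm),
      setLIntegral_const, residual, if_pos hbdd]
    · refine tendsto_nhds_unique (f := fun j => ENNReal.ofReal (upPath af bf y j) *
        M.P x (U j)) (l := atTop) ?_ ?_
      · refine ENNReal.Tendsto.mul (ENNReal.tendsto_ofReal htend) (Or.inr (measure_ne_top _ _))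
          (tendsto_measure_iInter_atTop (fun j => (hUm j).nullMeasurableSet)
            (M.upEvent_antitone A n y) ⟨0, measure_ne_top _ _⟩) (Or.inr ENNReal.ofReal_ne_top)
      · simp only [U, ofReal_mul_measure_upEvent M hker hab hx hy hA hAy]
        refine ENNReal.Tendsto.mul_const (ENNReal.tendsto_ofReal ?_) (Or.inr (measure_ne_top _ _))
        have := (tendsto_survival hab hy).const_mul y
        convert this using 2
        ring
    · filter_upwards [hlim] with ω hω hωU
      have hτ : drawdownAfter M.S n ω = ⊤ := by
        refine drawdownAfter_eq_top fun i hi => ?_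
        obtain ⟨k, rfl⟩ : ∃ k, i = n + (k + 1) := ⟨i - n - 1, by lia⟩
        rw [(mem_iInter.1 hωU (k + 1)).2 (k + 1) le_rfl, ← add_assoc, Nat.add_sub_cancel,
          (mem_iInter.1 hωU k).2 k le_rfl]
        exact (upPath_lt_succ hab hy k).le
      rw [evalAt_of_eq_top hτ, tendsto_nhds_unique (hω hωU) htend]
  · have hnull : M.P x (⋂ j, U j) = 0 := by
      refine measure_eq_zero_iff_ae_notMem.2 ?_
      filter_upwards [hlim] with ω hω hωU
      exact hbdd (hω hωU).bddAbove_range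
    rw [setLIntegral_measure_zero _ _ hnull, residual, if_neg hbdd]
    simp

lemma setLIntegral_drawdownAfter :
    ∫⁻ ω in A, ENNReal.ofReal (evalAt M.S M.Sinf (drawdownAfter M.S n) ω) ∂M.P x =
      ENNReal.ofReal (residual af bf y) * M.P x A := by
  set U := M.upEvent af bf A n y with hU
  set D : ℕ → Set Ω := fun j =>
    U j ∩ {ω | M.S (n + j + 1) ω = dnStep af bf (upPath af bf y j)} with hD
  have hUm : ∀ j, MeasurableSet (U j) := fun j =>
    M.F.le _ _ (M.measurableSet_upEvent hx hA y j)
  have hDm : ∀ j, MeasurableSet (D j) := fun j =>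
    (hUm j).inter (M.F.le _ _ (M.measurable_S hx (n + j + 1) (measurableSet_singleton _)))
  have hDU : ∀ j, Disjoint (D j) (U (j + 1)) := fun j => by
    rw [hU, upEvent_succ, upPath_succ]
    refine disjoint_left.2 fun ω h1 h2 => ?_
    have hp := upPath_pos hab hy j
    exact ((dnStep_lt hab hp).trans (lt_upStep hab hp)).ne (h1.2.symm.trans h2.2)
  have hdisj : Pairwise (Function.onFun Disjoint D) := by
    refine (pairwise_disjoint_on D).2 fun i j hij => ?_
    exact (hDU i).mono_right (inter_subset_left.trans (M.upEvent_antitone A n y hij))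
  have hdisjU : Disjoint (⋃ j, D j) (⋂ j, U j) := by
    refine disjoint_iUnion_left.2 fun j => (hDU j).mono_right (iInter_subset _ _)
  have hcover : A =ᵐ[M.P x] ((⋃ j, D j) ∪ ⋂ j, U j : Set Ω) := by
    refine eventuallyEq_set.2 ?_
    filter_upwards [ae_step M hker hab hx] with ω hω
    refine ⟨fun hωA => ?_, ?_⟩
    · by_contra hcon
      simp only [mem_union, not_or, mem_iUnion, not_exists] at hcon
      refine hcon.2 (mem_iInter.2 fun j => ?_)
      induction j with
      | zero => rw [hU, upEvent_zero M hAy]; exact hωA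
      | succ j ih =>
        rw [hU, upEvent_succ]
        refine ⟨ih, ?_⟩
        have hj : M.S (n + j) ω = upPath af bf y j := ih.2 j le_rfl
        rcases hω (n + j) with h | h
        · rw [mem_ofPred_eq, h, hj, upPath_succ]
        · exact absurd ⟨ih, by rw [mem_ofPred_eq, h, hj]⟩ (hcon.1 j)
    · rintro (h | h)
      · obtain ⟨j, hj⟩ := mem_iUnion.1 h
        exact hj.1.1
      · exact (mem_iInter.1 h 0).1
  have hanti : Antitone fun j => y * survival af bf y j := fun i j hij =>
    mul_le_mul_of_nonneg_left (survival_antitone hab hy hij) hy.le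
  have hsum : HasSum (fun j => y * survival af bf y j - y * survival af bf y (j + 1))
      (y * (1 - ⨅ j, survival af bf y j)) := by
    rw [hasSum_iff_tendsto_nat_of_nonneg fun j => sub_nonneg.2 (hanti (Nat.le_succ j))]
    simp only [Finset.sum_range_sub', survival_zero]
    have := ((tendsto_survival hab hy).const_mul y).const_sub (y * 1)
    rwa [← mul_sub] at this
  have hloss : 0 ≤ y * (1 - ⨅ j, survival af bf y j) :=
    mul_nonneg hy.le (sub_nonneg.2 (iInf_survival_le_one hab hy))
  have hres : 0 ≤ residual af bf y - y * (1 - ⨅ j, survival af bf y j) := by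
    unfold residual
    split_ifs
    · nlinarith [iInf_survival_nonneg hab hy]
    · simp
  rw [setLIntegral_congr hcover, lintegral_union (MeasurableSet.iInter hUm) hdisjU,
    lintegral_iUnion hDm hdisj, setLIntegral_drawdownAfter_of_up M hker hab hx hy hA hAy]
  simp only [hD, hU, setLIntegral_drawdownAfter_of_dnStep M hker hab hx hy hA hAy]
  rw [ENNReal.tsum_mul_right, ← ENNReal.ofReal_tsum_of_nonneg
    (fun j => sub_nonneg.2 (hanti (Nat.le_succ j))) hsum.summable, hsum.tsum_eq, ← add_mul,
    ← ENNReal.ofReal_add hloss hres]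
  ring_nf

omit hy in
lemma residual_eq_of_bounded (hbdd : M.Bounded x) (hpos : M.P x A ≠ 0) (hy : 0 < y) :
    residual af bf y = y := by
  obtain ⟨C, hC⟩ := hbdd
  refine if_pos ⟨C, ?_⟩
  rintro _ ⟨j, rfl⟩
  have hU : ∀ j, M.P x (M.upEvent af bf A n y j) ≠ 0 := fun j => by
    induction j with
    | zero => rwa [upEvent_zero M hAy]
    | succ j ih =>
      rw [measure_upEvent_succ M hker hab hx hy hA]
      refine mul_ne_zero ih (ENNReal.ofReal_pos.2 ?_).ne'
      linarith [(hab _ (upPath_pos hab hy j)).2.2]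
  by_contra! hlt
  refine hU j (measure_eq_zero_iff_ae_notMem.2 ?_)
  filter_upwards [hC] with ω hω hωU
  have := hω (n + j)
  rw [hωU.2 j le_rfl] at this
  exact this.not_gt hlt

end Binary

section DrawdownMass

variable {Ω : Type*} [MeasurableSpace Ω] (M : MarkovMartingale Ω) {af bf : ℝ → ℝ}
  (hker : ∀ x : ℝ, 0 < x →
    M.K x = ENNReal.ofReal (af x) • Measure.dirac (bf x * x / af x) +
      ENNReal.ofReal (1 - af x) • Measure.dirac ((1 - bf x) * x / (1 - af x)))
  (hab : ∀ x : ℝ, 0 < x → 0 ≤ bf x ∧ bf x < af x ∧ af x < 1)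

/-- The mass of the process at its `k`-th drawdown time. -/
noncomputable def drawdownMass (x : ℝ) (k : ℕ) : ENNReal :=
  ∫⁻ ω, ENNReal.ofReal (evalAt M.S M.Sinf (drawdown M.S k) ω) ∂M.P x

/-- The partition of the sample space according to the `k`-th drawdown time and the state then
occupied. -/
def drawdownCell (af bf : ℝ → ℝ) (x : ℝ) (k : ℕ) : Option (ℕ × ⋃ n, reach af bf x n) → Set Ω
  | none => {ω | drawdown M.S k ω = ⊤}
  | some (n, v) => {ω | drawdown M.S k ω = n} ∩ {ω | M.S n ω = v}

variable {x : ℝ} (hx : 0 < x)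

include hx

lemma measurableSet_inter_drawdown (k n : ℕ) (v : ℝ) :
    MeasurableSet[M.F n] ({ω | drawdown M.S k ω = n} ∩ {ω | M.S n ω = v}) :=
  (measurableSet_drawdown_eq_coe (M.mart x hx).1 k n).inter
    (M.measurable_S hx n (measurableSet_singleton v))

lemma measurableSet_drawdownCell (k : ℕ) (i) :
    MeasurableSet (M.drawdownCell af bf x k i) := by
  rcases i with _ | ⟨n, v⟩
  · exact measurable_drawdown (M.mart x hx).1 k (measurableSet_singleton ⊤)
  · exact M.F.le n _ (M.measurableSet_inter_drawdown hx k n v)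

omit hx in
lemma pairwise_disjoint_drawdownCell (k : ℕ) :
    Pairwise (Function.onFun Disjoint (M.drawdownCell af bf x k)) := by
  rintro i j hij
  refine disjoint_left.2 fun ω hi hj => hij ?_
  rcases i with _ | ⟨n, v⟩ <;> rcases j with _ | ⟨m, w⟩
  · rfl
  · exact absurd (hi.symm.trans hj.1) (ENat.top_ne_natCast m)
  · exact absurd (hj.symm.trans hi.1) (ENat.top_ne_natCast n)
  · have hnm : n = m := Nat.cast_injective (R := ℕ∞) (hi.1.symm.trans hj.1)
    subst hnm
    rw [Subtype.ext (hi.2.symm.trans hj.2)]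

include hker hab

lemma lintegral_eq_tsum_drawdownCell (k : ℕ) (f : Ω → ENNReal) :
    ∫⁻ ω, f ω ∂M.P x = ∑' i, ∫⁻ ω in M.drawdownCell af bf x k i, f ω ∂M.P x := by
  have : Countable (⋃ n, reach af bf x n : Set ℝ) :=
    (countable_iUnion (countable_reach x)).to_subtype
  rw [← lintegral_iUnion (M.measurableSet_drawdownCell hx k)
    (M.pairwise_disjoint_drawdownCell k), ← setLIntegral_univ]
  refine setLIntegral_congr (eventuallyEq_set.2 ?_)
  filter_upwards [ae_all_iff.2 (ae_mem_reach M hker hab hx)] with ω hω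
  refine ⟨fun _ => ?_, fun _ => mem_univ ω⟩
  induction hd : drawdown M.S k ω using ENat.recTopCoe with
  | top => exact mem_iUnion.2 ⟨none, hd⟩
  | coe n => exact mem_iUnion.2 ⟨some (n, ⟨M.S n ω, mem_iUnion.2 ⟨n, hω n⟩⟩), hd, rfl⟩

lemma state_pos (v : ⋃ n, reach af bf x n) : 0 < (v : ℝ) := by
  obtain ⟨n, hn⟩ := mem_iUnion.1 v.2
  exact reach_pos M hker hab hx n v hn

omit hker hab in
lemma setLIntegral_drawdownCell_none (k : ℕ) :
    ∫⁻ ω in M.drawdownCell af bf x k none,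
        ENNReal.ofReal (evalAt M.S M.Sinf (drawdown M.S (k + 1)) ω) ∂M.P x =
      ∫⁻ ω in M.drawdownCell af bf x k none,
        ENNReal.ofReal (evalAt M.S M.Sinf (drawdown M.S k) ω) ∂M.P x := by
  refine setLIntegral_congr_fun (M.measurableSet_drawdownCell hx k none) fun ω hω => ?_
  simp only [evalAt_of_eq_top hω, evalAt_of_eq_top (drawdown_succ_of_eq_top hω)]

omit hker hab in
lemma setLIntegral_drawdownCell_some (k n : ℕ) (v) :
    ∫⁻ ω in M.drawdownCell af bf x k (some (n, v)),
        ENNReal.ofReal (evalAt M.S M.Sinf (drawdown M.S k) ω) ∂M.P x =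
      ENNReal.ofReal v * M.P x (M.drawdownCell af bf x k (some (n, v))) := by
  rw [setLIntegral_congr_fun (g := fun _ => ENNReal.ofReal v)
    (M.measurableSet_drawdownCell hx k _), setLIntegral_const]
  rintro ω ⟨hτ, hv⟩
  simp only [evalAt_of_eq_coe hτ]
  rw [hv]

lemma setLIntegral_drawdownCell_some_succ (k n : ℕ) (v) :
    ∫⁻ ω in M.drawdownCell af bf x k (some (n, v)),
        ENNReal.ofReal (evalAt M.S M.Sinf (drawdown M.S (k + 1)) ω) ∂M.P x =
      ENNReal.ofReal (residual af bf v) *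
        M.P x (M.drawdownCell af bf x k (some (n, v))) := by
  refine Eq.trans ?_ (setLIntegral_drawdownAfter M hker hab hx (state_pos M hker hab hx v)
    (M.measurableSet_inter_drawdown hx k n v) fun ω hω => hω.2)
  refine setLIntegral_congr_fun (M.measurableSet_drawdownCell hx k _) fun ω hω => ?_
  simp only [evalAt, drawdown_succ_of_eq_coe hω.1]

lemma setLIntegral_drawdownCell_succ_le (k : ℕ) (i) :
    ∫⁻ ω in M.drawdownCell af bf x k i,
        ENNReal.ofReal (evalAt M.S M.Sinf (drawdown M.S (k + 1)) ω) ∂M.P x ≤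
      ∫⁻ ω in M.drawdownCell af bf x k i,
        ENNReal.ofReal (evalAt M.S M.Sinf (drawdown M.S k) ω) ∂M.P x := by
  rcases i with _ | ⟨n, v⟩
  · exact (M.setLIntegral_drawdownCell_none hx k).le
  · rw [setLIntegral_drawdownCell_some_succ M hker hab hx,
      M.setLIntegral_drawdownCell_some hx]
    gcongr
    exact residual_le hab (state_pos M hker hab hx v)

omit hker hab in
lemma drawdownMass_zero : M.drawdownMass x 0 = ENNReal.ofReal x := by
  have := M.prob x hx
  rw [drawdownMass, lintegral_congr_ae (g := fun _ => ENNReal.ofReal x)]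
  · simp
  · filter_upwards [M.start x hx] with ω hω
    rw [evalAt_of_eq_coe (τ := drawdown M.S 0) (n := 0) rfl, hω]

lemma drawdownMass_antitone : Antitone (M.drawdownMass x) :=
  antitone_nat_of_succ_le fun k => by
    rw [drawdownMass, drawdownMass, lintegral_eq_tsum_drawdownCell M hker hab hx k,
      lintegral_eq_tsum_drawdownCell M hker hab hx k]
    exact ENNReal.tsum_le_tsum (setLIntegral_drawdownCell_succ_le M hker hab hx k)

lemma drawdownMass_le (k : ℕ) : M.drawdownMass x k ≤ ENNReal.ofReal x :=
  (drawdownMass_antitone M hker hab hx (Nat.zero_le k)).trans (M.drawdownMass_zero hx).le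

lemma bubble_iff : M.Bubble x ↔ ∃ k, M.drawdownMass x (k + 1) < ENNReal.ofReal x := by
  have := M.prob x hx
  have hstart : ∫ ω, M.S 0 ω ∂M.P x = x := by
    rw [integral_congr_ae (g := fun _ => x) (M.start x hx)]
    simp
  have hSinf : AEMeasurable M.Sinf (M.P x) :=
    aemeasurable_of_tendsto_metrizable_ae atTop
      (fun n => (((M.mart x hx).1 n).mono (M.F.le n)).measurable.aemeasurable) (M.conv x hx)
  refine exists_congr fun k => ?_
  have hnonneg : 0 ≤ᵐ[M.P x] evalAt M.S M.Sinf (drawdown M.S (k + 1)) := by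
    filter_upwards [M.pos x hx, M.conv x hx] with ω hpos hconv
    simp only [evalAt, Pi.zero_apply]
    split_ifs
    · exact ge_of_tendsto' hconv fun n => (hpos n).le
    · exact (hpos _).le
  have hmeas := aemeasurable_evalAt (M.mart x hx).1 hSinf
    (measurable_drawdown (M.mart x hx).1 (k + 1))
  have hfin : M.drawdownMass x (k + 1) ≠ ⊤ :=
    ne_top_of_le_ne_top ENNReal.ofReal_ne_top (drawdownMass_le M hker hab hx (k + 1))
  rw [hstart, integral_eq_lintegral_of_nonneg_ae hnonneg hmeas.aestronglyMeasurable]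
  exact (ENNReal.lt_ofReal_iff_toReal_lt hfin).symm

/-- No mass is lost as long as the process does not reach a state from which the first drawdown
loses mass. -/
lemma drawdownMass_eq (h : ∀ k n v, M.P x (M.drawdownCell af bf x k (some (n, v))) ≠ 0 →
    residual af bf v = v) (k : ℕ) : M.drawdownMass x k = ENNReal.ofReal x := by
  induction k with
  | zero => exact M.drawdownMass_zero hx
  | succ k ih =>
    rw [← ih, drawdownMass, drawdownMass, lintegral_eq_tsum_drawdownCell M hker hab hx k,
      lintegral_eq_tsum_drawdownCell M hker hab hx k]
    refine tsum_congr fun i => ?_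
    rcases i with _ | ⟨n, v⟩
    · exact M.setLIntegral_drawdownCell_none hx k
    · rw [setLIntegral_drawdownCell_some_succ M hker hab hx,
        M.setLIntegral_drawdownCell_some hx]
      by_cases h0 : M.P x (M.drawdownCell af bf x k (some (n, v))) = 0
      · simp [h0]
      · rw [h k n v h0]

lemma residual_eq_of_not_bubble (hbub : ¬ M.Bubble x) (k n : ℕ) (v)
    (h0 : M.P x (M.drawdownCell af bf x k (some (n, v))) ≠ 0) : residual af bf v = v := by
  have := M.prob x hx
  rw [M.bubble_iff hker hab hx] at hbub
  push Not at hbub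
  have hle : M.drawdownMass x k ≤ M.drawdownMass x (k + 1) :=
    (drawdownMass_le M hker hab hx k).trans (hbub k)
  have hfin : M.drawdownMass x (k + 1) ≠ ⊤ :=
    ne_top_of_le_ne_top ENNReal.ofReal_ne_top (drawdownMass_le M hker hab hx (k + 1))
  have hv := state_pos M hker hab hx v
  by_contra hne
  have hlt := lt_of_le_of_ne (residual_le hab hv) hne
  refine hle.not_gt ?_
  rw [drawdownMass, lintegral_eq_tsum_drawdownCell M hker hab hx k] at hfin
  rw [drawdownMass, drawdownMass, lintegral_eq_tsum_drawdownCell M hker hab hx k,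
    lintegral_eq_tsum_drawdownCell M hker hab hx k (fun ω => ENNReal.ofReal
      (evalAt M.S M.Sinf (drawdown M.S k) ω))]
  refine ENNReal.tsum_lt_tsum hfin (setLIntegral_drawdownCell_succ_le M hker hab hx k)
    (i := some (n, v)) ?_
  rw [setLIntegral_drawdownCell_some_succ M hker hab hx, M.setLIntegral_drawdownCell_some hx]
  exact (ENNReal.mul_lt_mul_iff_left h0 (measure_ne_top _ _)).2
    ((ENNReal.ofReal_lt_ofReal_iff hv).2 hlt)

/-- At every time the process lies on the upward path issued from its state at the latest
drawdown. -/
lemma ae_exists_upPath : ∀ᵐ ω ∂M.P x, ∀ n, ∃ k m j : ℕ,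
    drawdown M.S k ω = m ∧ M.S n ω = upPath af bf (M.S m ω) j := by
  filter_upwards [M.pos x hx, ae_step M hker hab hx] with ω hpos hstep n
  suffices h : ∃ k m j : ℕ, m ≤ n ∧ (∀ i, m < i → i ≤ n → M.S (i - 1) ω ≤ M.S i ω) ∧
      drawdown M.S k ω = m ∧ M.S n ω = upPath af bf (M.S m ω) j by
    obtain ⟨k, m, j, -, -, h⟩ := h
    exact ⟨k, m, j, h⟩
  induction n with
  | zero => exact ⟨0, 0, 0, le_rfl, fun i hi hi' => by lia, rfl, rfl⟩
  | succ n ih =>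
    obtain ⟨k, m, j, hmn, hup, hk, hj⟩ := ih
    rcases hstep n with h | h
    · refine ⟨k, m, j + 1, by lia, fun i hi hi' => ?_, hk, by rw [h, hj, upPath_succ]⟩
      rcases Nat.le_succ_iff.1 hi' with h' | rfl
      · exact hup i hi h'
      · rw [Nat.succ_eq_add_one, Nat.add_sub_cancel, h]
        exact (lt_upStep hab (hpos n)).le
    · refine ⟨k + 1, n + 1, 0, le_rfl, fun i hi hi' => by lia, ?_, rfl⟩
      refine drawdown_succ_eq_coe_iff.2 ⟨m, hk, by lia, ?_, fun i hi hi' => hup i hi (by lia)⟩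
      rw [Nat.add_sub_cancel, h]
      exact dnStep_lt hab (hpos n)

end DrawdownMass

end MarkovMartingale

/-- For the complete-market (binary) Markov martingale with kernel
`K(x,·) = a(x) δ_{b(x)x/a(x)} + (1-a(x)) δ_{(1-b(x))x/(1-a(x))}`, where `0 ≤ b(x) < a(x) < 1`,
`0 < liminf a ≤ limsup a < 1` at infinity and `b` is nonincreasing on `[x_b, ∞)`:
`S` is a bubble under `P_x` iff `S` is not `P_x`-a.s. bounded and
`∫_{log x_b}^∞ b(e^u) du < ∞`. -/
theorem MarkovMartingale.binary_bubble_iff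
    {Ω : Type*} [MeasurableSpace Ω] (M : MarkovMartingale Ω)
    (af bf : ℝ → ℝ)
    (hker : ∀ x : ℝ, 0 < x →
      M.K x = ENNReal.ofReal (af x) • Measure.dirac (bf x * x / af x) +
        ENNReal.ofReal (1 - af x) • Measure.dirac ((1 - bf x) * x / (1 - af x)))
    (hab : ∀ x : ℝ, 0 < x → 0 ≤ bf x ∧ bf x < af x ∧ af x < 1)
    (hliminf : ∃ c > (0 : ℝ), ∀ᶠ x in atTop, c ≤ af x)
    (hlimsup : ∃ c < (1 : ℝ), ∀ᶠ x in atTop, af x ≤ c)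
    {xb : ℝ} (hxb : 0 < xb) (hmono : AntitoneOn bf (Set.Ici xb)) :
    ∀ x : ℝ, 0 < x →
      (M.Bubble x ↔
        (¬ M.Bounded x ∧
          IntegrableOn (fun u => bf (Real.exp u)) (Set.Ici (Real.log xb)))) := by
  intro x hx
  constructor
  · intro hbub
    by_contra hcon
    obtain ⟨k, hk⟩ := (M.bubble_iff hker hab hx).1 hbub
    refine hk.ne (M.drawdownMass_eq hker hab hx (fun k n v h0 => ?_) (k + 1))
    have hv := M.state_pos hker hab hx v
    by_cases hbdd : M.Bounded x
    · exact M.residual_eq_of_bounded hker hab hx (M.measurableSet_inter_drawdown hx k n v)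
        (fun ω hω => hω.2) hbdd h0 hv
    · by_cases hunb : BddAbove (range (upPath af bf v))
      · exact if_pos hunb
      · have hns : ¬ Summable fun i => bf (upPath af bf v i) := fun hs =>
          hcon ⟨hbdd, integrableOn_of_summable hab hxb hmono hlimsup hv hunb hs⟩
        rw [residual, if_neg hunb, iInf_survival_eq_zero_of_not_summable hab hv hns, sub_zero,
          mul_one]
  · rintro ⟨hunb, hint⟩
    by_contra hbub
    obtain ⟨C, hC⟩ := exists_escape_level hab hxb hmono hliminf hint
    refine hunb ⟨C, ?_⟩
    have : Countable (⋃ n, reach af bf x n : Set ℝ) :=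
      (countable_iUnion (countable_reach x)).to_subtype
    have hcell : ∀ᵐ ω ∂M.P x, ∀ k n v, ω ∈ M.drawdownCell af bf x k (some (n, v)) →
        ∀ j, upPath af bf v j ≤ C := by
      refine ae_all_iff.2 fun k => ae_all_iff.2 fun n => ae_all_iff.2 fun v => ?_
      by_cases h0 : M.P x (M.drawdownCell af bf x k (some (n, v))) = 0
      · filter_upwards [measure_eq_zero_iff_ae_notMem.1 h0] with ω hω hmem
        exact absurd hmem hω
      · refine Eventually.of_forall fun ω _ j => ?_
        by_contra! hlt
        exact (hC v (M.state_pos hker hab hx v) j hlt).ne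
          (M.residual_eq_of_not_bubble hker hab hx hbub k n v h0)
    filter_upwards [hcell, M.ae_exists_upPath hker hab hx,
      ae_all_iff.2 (M.ae_mem_reach hker hab hx)] with ω hω hpath hreach n
    obtain ⟨k, m, j, hk, hj⟩ := hpath n
    rw [hj]
    exact hω k m ⟨M.S m ω, mem_iUnion.2 ⟨m, hreach m⟩⟩ ⟨hk, rfl⟩ j
end
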